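/- There is a universal constant C > 0 with the following property. Let T : ℂ^n → ℂ^N be injective with balancing parameter γ, ‖γ T*T − I_n‖ < 1, and incoherence parameter μ. Let Ω = {ω_1,…,ω_m} be i.i.d. uniform random indices in [n], let x ∈ ℂ^n have T x s-sparse, let x♯ satisfy ‖S_{Ω'}(x − x♯)‖_2 ≤ ε, and let x̂ be a minimizer of (Pε): minimize ‖T g‖_1 subject to ‖S_{Ω'}(g − x♯)‖_2 ≤ ε. If m ≥ C μ s log⁴ N / (1 − ‖γ T*T − I_n‖), then with probability at least 1 − N^{−4}, ‖x̂ − x‖_2 ≤ (σ_max(T)/σ_min(T)) · [ 14√N + (n/m)( ‖T‖_{1→2} ‖T†‖_{2→∞} (|Ω| − |Ω'|) + 1 ) ] · ε. Furthermore, if T*T = I_n, then with probability at least 1 − N^{−4}, ‖x̂ − x‖_2 ≤ (σ_max(T)/σ_min(T)) · ( 14√N + (n/m)·R ) · ε, where R is the maximal multiplicity of an element of the multiset Ω. -/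

import Mathlib

open scoped BigOperators ENNReal
open Classical MeasureTheory
open scoped Matrix

noncomputable section

namespace TSR

/-- ℓ2 norm of a finite complex vector. -/
def l2norm {d : ℕ} (v : Fin d → ℂ) : ℝ := Real.sqrt (∑ i, ‖v i‖ ^ 2)

/-- ℓ1 norm of a finite complex vector. -/
def l1norm {d : ℕ} (v : Fin d → ℂ) : ℝ := ∑ i, ‖v i‖

/-- ℓ∞ norm of a finite complex vector. -/
def linfnorm {d : ℕ} (v : Fin d → ℂ) : ℝ := ⨆ i, ‖v i‖

/-- Spectral norm (`ℓ2 → ℓ2` operator norm) of a matrix. -/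
def specNorm {d e : ℕ} (A : Matrix (Fin d) (Fin e) ℂ) : ℝ :=
  ‖LinearMap.toContinuousLinearMap (Matrix.toEuclideanLin A)‖

/-- Largest singular value. -/
def sigmaMax {d e : ℕ} (A : Matrix (Fin d) (Fin e) ℂ) : ℝ := specNorm A

/-- Smallest singular value: the infimum of `‖A v‖₂` over unit vectors `v`. -/
def sigmaMin {d e : ℕ} (A : Matrix (Fin d) (Fin e) ℂ) : ℝ :=
  sInf {r : ℝ | ∃ v : Fin e → ℂ, l2norm v = 1 ∧ r = l2norm (A.mulVec v)}

/-- Maximum ℓ2 norm of the columns of a matrix (the `1 → 2` operator norm). -/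
def maxColL2 {d e : ℕ} (A : Matrix (Fin d) (Fin e) ℂ) : ℝ :=
  ⨆ k : Fin e, l2norm (fun i => A i k)

/-- `B` is the Moore–Penrose pseudoinverse of `A` (the four Penrose conditions). -/
def IsMoorePenrose {ι κ : Type*} [Fintype ι] [Fintype κ] [DecidableEq ι] [DecidableEq κ]
    (A : Matrix ι κ ℂ) (B : Matrix κ ι ℂ) : Prop :=
  A * B * A = A ∧ B * A * B = B ∧ (A * B)ᴴ = A * B ∧ (B * A)ᴴ = B * A

/-- `γ > 0` minimizes `‖γ' T*T − I‖` over `γ' > 0` (the balancing parameter). -/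
def IsBalancing {e d : ℕ} (T : Matrix (Fin d) (Fin e) ℂ) (γ : ℝ) : Prop :=
  0 < γ ∧ ∀ γ' : ℝ, 0 < γ' →
    specNorm ((γ : ℂ) • (Tᴴ * T) - 1) ≤ specNorm ((γ' : ℂ) • (Tᴴ * T) - 1)

/-- Local incoherence parameter `n γ ‖A e_k‖_∞²` of the `k`-th column. -/
def locIncoh {e d : ℕ} (γ : ℝ) (A : Matrix (Fin d) (Fin e) ℂ) (k : Fin e) : ℝ :=
  (e : ℝ) * γ * (linfnorm fun i => A i k) ^ 2

/-- The (worst case) incoherence parameter `μ`. -/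
def incoherence {e d : ℕ} (γ : ℝ) (T Ttil : Matrix (Fin d) (Fin e) ℂ) : ℝ :=
  ⨆ k : Fin e, max (locIncoh γ T k) (locIncoh γ⁻¹ Ttil k)

/-- The variable-density weight `√(μ_k μ̃_k)`. -/
def vdWeight {e d : ℕ} (γ : ℝ) (T Ttil : Matrix (Fin d) (Fin e) ℂ) (k : Fin e) : ℝ :=
  Real.sqrt (locIncoh γ T k * locIncoh γ⁻¹ Ttil k)

/-- The average incoherence parameter `μ̄ = (1/n) ∑ √(μ_k μ̃_k)`. -/
def avgIncoh {e d : ℕ} (γ : ℝ) (T Ttil : Matrix (Fin d) (Fin e) ℂ) : ℝ :=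
  (1 / (e : ℝ)) * ∑ k, vdWeight γ T Ttil k

/-- The sampling matrix `S_Ω` of a multiset of indices `ω : Fin m → Fin n`. -/
def sampMat {n m : ℕ} (ω : Fin m → Fin n) : Matrix (Fin m) (Fin n) ℂ :=
  fun j k => if ω j = k then 1 else 0

/-- Coordinate projection `Π_J` onto a set of coordinates, as a matrix. -/
def projMat {d : ℕ} (J : Set (Fin d)) : Matrix (Fin d) (Fin d) ℂ :=
  fun i j => if i = j ∧ i ∈ J then 1 else 0

/-- Number of non-zero entries. -/
def sparsity {d : ℕ} (v : Fin d → ℂ) : ℕ :=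
  (Finset.univ.filter fun i => v i ≠ 0).card

/-- Number of distinct elements of the multiset `Ω` (that is, `|Ω'|`). -/
def distinctCard {n m : ℕ} (ω : Fin m → Fin n) : ℕ :=
  (Finset.image ω Finset.univ).card

/-- Maximal multiplicity of an element of the multiset `Ω`. -/
def maxMult {n m : ℕ} (ω : Fin m → Fin n) : ℕ :=
  Finset.univ.sup fun k : Fin n => (Finset.univ.filter fun j => ω j = k).card

/-- Entrywise complex signum. -/
def csgn {d : ℕ} (z : Fin d → ℂ) : Fin d → ℂ :=
  fun k => if z k = 0 then 0 else z k / (‖z k‖ : ℂ)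

/-- `G` is a partition of the coordinates into disjoint nonempty groups. -/
def IsPartition {L N : ℕ} (G : Fin N → Finset (Fin L)) : Prop :=
  (∀ j, (G j).Nonempty) ∧ (∀ j j', j ≠ j' → Disjoint (G j) (G j')) ∧
    Finset.univ.biUnion G = Finset.univ

/-- The mixed (group) norm `‖z‖_{𝒢,1} = ∑_j ‖Π_{𝒢_j} z‖₂`. -/
def mixedNorm {L N : ℕ} (G : Fin N → Finset (Fin L)) (z : Fin L → ℂ) : ℝ :=
  ∑ j, Real.sqrt (∑ i ∈ G j, ‖z i‖ ^ 2)

/-- `z` is `(s,t)` strongly group sparse with respect to the partition `G`. -/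
def StronglyGroupSparse {L N : ℕ} (G : Fin N → Finset (Fin L)) (s t : ℕ)
    (z : Fin L → ℂ) : Prop :=
  ∃ J : Finset (Fin N), (∀ i, z i ≠ 0 → i ∈ J.biUnion G) ∧
    (J.biUnion G).card ≤ t ∧ J.card ≤ s

/-- Group local incoherence `max_j n γ ‖Π_{𝒢_j} A e_k‖₂²`. -/
def groupLocIncoh {n L N : ℕ} (G : Fin N → Finset (Fin L)) (γ : ℝ)
    (A : Matrix (Fin L) (Fin n) ℂ) (k : Fin n) : ℝ :=
  ⨆ j : Fin N, (n : ℝ) * γ * ∑ i ∈ G j, ‖A i k‖ ^ 2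

/-- Group incoherence parameter `μ_𝒢`. -/
def groupIncoh {n L N : ℕ} (G : Fin N → Finset (Fin L)) (γ : ℝ)
    (T Ttil : Matrix (Fin L) (Fin n) ℂ) : ℝ :=
  ⨆ k : Fin n, max (groupLocIncoh G γ T k) (groupLocIncoh G γ⁻¹ Ttil k)

/-- Group variable density weight `√(μ_{𝒢,k} μ̃_{𝒢,k})`. -/
def groupVdWeight {n L N : ℕ} (G : Fin N → Finset (Fin L)) (γ : ℝ)
    (T Ttil : Matrix (Fin L) (Fin n) ℂ) (k : Fin n) : ℝ :=
  Real.sqrt (groupLocIncoh G γ T k * groupLocIncoh G γ⁻¹ Ttil k)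

/-- Group average incoherence `μ̄_𝒢`. -/
def groupAvgIncoh {n L N : ℕ} (G : Fin N → Finset (Fin L)) (γ : ℝ)
    (T Ttil : Matrix (Fin L) (Fin n) ℂ) : ℝ :=
  (1 / (n : ℝ)) * ∑ k, groupVdWeight G γ T Ttil k

/-- The unitary DFT matrix. -/
def dft (n : ℕ) : Matrix (Fin n) (Fin n) ℂ :=
  fun j k => ((1 / Real.sqrt n : ℝ) : ℂ) *
    Complex.exp (-(2 * Real.pi * Complex.I * (j : ℕ) * (k : ℕ)) / n)

/-- Probability of `P` under the uniform distribution on a finite type. -/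
def unifProb {α : Type*} [Fintype α] (P : α → Prop) : ℝ :=
  ((Finset.univ.filter P).card : ℝ) / Fintype.card α

section UnifProb

variable {α β ι : Type*} [Fintype α] [Fintype β] [Fintype ι]

lemma unifProb_eq (P : α → Prop) [DecidablePred P] :
    unifProb P = ((Finset.univ.filter P).card : ℝ) / Fintype.card α := by
  unfold unifProb
  congr!

lemma unifProb_nonneg (P : α → Prop) : 0 ≤ unifProb P := by
  unfold unifProb; positivity

lemma unifProb_mono {P Q : α → Prop} (h : ∀ a, P a → Q a) : unifProb P ≤ unifProb Q := by
  unfold unifProb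
  gcongr with a
  exact h a

lemma unifProb_or_le (P Q : α → Prop) :
    unifProb (fun a => P a ∨ Q a) ≤ unifProb P + unifProb Q := by
  rw [unifProb_eq, unifProb_eq, unifProb_eq, ← add_div]
  gcongr
  have hsub : (Finset.univ.filter fun a => P a ∨ Q a)
      ⊆ Finset.univ.filter P ∪ Finset.univ.filter Q := fun a => by simp
  exact_mod_cast (Finset.card_le_card hsub).trans (Finset.card_union_le _ _)

lemma unifProb_exists_le (P : ι → α → Prop) {p : ℝ} (h : ∀ i, unifProb (P i) ≤ p) :
    unifProb (fun a => ∃ i, P i a) ≤ Fintype.card ι * p := by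
  calc unifProb (fun a => ∃ i, P i a) ≤ ∑ i, unifProb (P i) := by
        simp only [unifProb_eq]
        rw [← Finset.sum_div]
        gcongr
        have hsub : (Finset.univ.filter fun a => ∃ i, P i a)
            ⊆ Finset.univ.biUnion fun i => Finset.univ.filter (P i) := fun a => by simp
        exact_mod_cast (Finset.card_le_card hsub).trans Finset.card_biUnion_le
    _ ≤ ∑ _i : ι, p := Finset.sum_le_sum fun i _ => h i
    _ = Fintype.card ι * p := by simp

lemma unifProb_equiv (e : α ≃ β) (P : β → Prop) :
    unifProb (fun a => P (e a)) = unifProb P := by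
  unfold unifProb
  rw [Fintype.card_congr e]
  congr 2
  refine Finset.card_bij (fun a _ => e a) ?_ ?_ ?_
  · intro a; simp
  · intro a _ b _; simp
  · intro b hb
    exact ⟨e.symm b, by simpa using hb, by simp⟩

lemma unifProb_prod_le {P : α → β → Prop} {p : ℝ} (hp : 0 ≤ p)
    (h : ∀ a, unifProb (P a) ≤ p) : unifProb (fun x : α × β => P x.1 x.2) ≤ p := by
  unfold unifProb at *
  refine div_le_of_le_mul₀ (by positivity) hp ?_
  have key : ∀ a, ((Finset.univ.filter (P a)).card : ℝ) ≤ p * Fintype.card β := by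
    intro a
    rcases Nat.eq_zero_or_pos (Fintype.card β) with h0 | h0
    · have : (Finset.univ.filter (P a)).card ≤ Fintype.card β := Finset.card_le_univ _
      rw [h0] at this ⊢
      simp [Nat.le_zero.mp this]
    · exact (div_le_iff₀ (by exact_mod_cast h0)).mp (h a)
  have e : (Finset.univ.filter fun x : α × β => P x.1 x.2).card
      = ∑ a, (Finset.univ.filter (P a)).card := by
    simp only [Finset.card_filter]
    rw [Fintype.sum_prod_type]
  rw [e, Nat.cast_sum, Fintype.card_prod]
  calc ∑ a, ((Finset.univ.filter (P a)).card : ℝ) ≤ ∑ _a : α, p * Fintype.card β :=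
        Finset.sum_le_sum fun a _ => key a
    _ = p * ((Fintype.card α * Fintype.card β : ℕ) : ℝ) := by
        simp; ring

lemma unifProb_fst_le (P : α → Prop) :
    unifProb (fun x : α × β => P x.1) ≤ unifProb P := by
  rw [← unifProb_equiv (Equiv.prodComm β α)]
  exact unifProb_prod_le (P := fun _ a => P a) (unifProb_nonneg P) fun _ => le_rfl

end UnifProb

/-- Chernoff bound for a sum of independent uniform samples of a function bounded by one. -/
lemma unifProb_chernoff {n m : ℕ} {g : Fin n → ℝ} (hg : ∀ k, |g k| ≤ 1) {w : ℝ} (t : ℝ)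
    (hw : ∑ k, (g k + g k ^ 2) ≤ n * w) :
    unifProb (fun b : Fin m → Fin n => m * w + t ≤ ∑ j, g (b j)) ≤ Real.exp (-t) := by
  have hsum : ∑ k, Real.exp (g k) ≤ n * Real.exp w := by
    calc ∑ k, Real.exp (g k) ≤ ∑ k, (1 + (g k + g k ^ 2)) := by
          refine Finset.sum_le_sum fun k _ => ?_
          have := (abs_le.mp (Real.abs_exp_sub_one_sub_id_le (hg k))).2
          linarith
      _ = n + ∑ k, (g k + g k ^ 2) := by simp [Finset.sum_add_distrib]
      _ ≤ n * (w + 1) := by linarith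
      _ ≤ n * Real.exp w := by gcongr; exact Real.add_one_le_exp w
  have hpow : ∑ b : Fin m → Fin n, Real.exp (∑ j, g (b j)) ≤ (n * Real.exp w) ^ m := by
    calc ∑ b : Fin m → Fin n, Real.exp (∑ j, g (b j)) = (∑ k, Real.exp (g k)) ^ m := by
          rw [Fintype.sum_pow]
          exact Finset.sum_congr rfl fun b _ => Real.exp_sum _ _
      _ ≤ _ := pow_le_pow_left₀ (Finset.sum_nonneg fun _ _ => (Real.exp_pos _).le) hsum m
  set S := Finset.univ.filter fun b : Fin m → Fin n => m * w + t ≤ ∑ j, g (b j) with hS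
  have hmarkov : (S.card : ℝ) * Real.exp (m * w + t) ≤ (n * Real.exp w) ^ m := by
    refine le_trans ?_ hpow
    rw [← nsmul_eq_mul, ← Finset.sum_const]
    calc ∑ _b ∈ S, Real.exp (m * w + t) ≤ ∑ b ∈ S, Real.exp (∑ j, g (b j)) := by
          refine Finset.sum_le_sum fun b hb => Real.exp_le_exp.mpr ?_
          simpa [hS] using hb
      _ ≤ _ := Finset.sum_le_sum_of_subset_of_nonneg (Finset.subset_univ _)
          fun _ _ _ => (Real.exp_pos _).le
  unfold unifProb
  refine div_le_of_le_mul₀ (by positivity) (Real.exp_pos _).le ?_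
  rw [mul_pow, ← Real.exp_nat_mul, Real.exp_add, mul_comm ((n : ℝ) ^ m), ← mul_assoc,
    mul_comm (S.card : ℝ), mul_assoc] at hmarkov
  have h1 : (S.card : ℝ) * Real.exp t ≤ (n : ℝ) ^ m := by
    exact le_of_mul_le_mul_left hmarkov (Real.exp_pos _)
  have hc : ((Fintype.card (Fin m → Fin n) : ℕ) : ℝ) = (n : ℝ) ^ m := by simp
  rw [hc, Real.exp_neg, inv_mul_eq_div, le_div_iff₀ (Real.exp_pos _)]
  exact h1

/-- Some stage of the adaptive process `q ↦ step q b` fed with the batches `b i` is bad. -/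
def stageFails {V B : Type*} (bad : V → B → Prop) (step : V → B → V) :
    (L : ℕ) → V → (Fin L → B) → Prop
  | 0, _, _ => False
  | L + 1, q, b => bad q (b 0) ∨ stageFails bad step L (step q (b 0)) (Fin.tail b)

lemma unifProb_stageFails_le {V B : Type*} [Fintype B] {bad : V → B → Prop}
    {step : V → B → V} {p : ℝ} (hp : 0 ≤ p) (h : ∀ q, unifProb (bad q) ≤ p) (L : ℕ) (q : V) :
    unifProb (stageFails bad step L q) ≤ L * p := by
  induction L generalizing q with
  | zero => simp [stageFails, unifProb]
  | succ L ih =>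
    rw [← unifProb_equiv (Fin.consEquiv fun _ : Fin (L + 1) => B)]
    simp only [stageFails, Fin.consEquiv, Equiv.coe_fn_mk, Fin.cons_zero, Fin.tail_cons]
    refine (unifProb_or_le _ _).trans ?_
    have h1 : unifProb (fun x : B × (Fin L → B) => bad q x.1) ≤ p :=
      (unifProb_fst_le _).trans (h q)
    have h2 : unifProb (fun x : B × (Fin L → B) => stageFails bad step L (step q x.1) x.2)
        ≤ L * p :=
      unifProb_prod_le (P := fun b r => stageFails bad step L (step q b) r) (by positivity)
        fun b => ih _
    push_cast
    linarith

/-- Cut the first `L * k` entries of a tuple into `L` consecutive batches of length `k`. -/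
def batches {α : Type*} {m L k : ℕ} (h : L * k ≤ m) (ω : Fin m → α) : Fin L → Fin k → α :=
  fun i j => ω (Fin.castLE h (finProdFinEquiv (i, j)))

lemma unifProb_batches_le {α : Type*} [Fintype α] {m L k : ℕ} (h : L * k ≤ m)
    (Q : (Fin L → Fin k → α) → Prop) :
    unifProb (fun ω : Fin m → α => Q (batches h ω)) ≤ unifProb Q := by
  obtain ⟨r, rfl⟩ := Nat.exists_eq_add_of_le h
  let e : (Fin (L * k + r) → α) ≃ (Fin L → Fin k → α) × (Fin r → α) :=
    ((Equiv.arrowCongr finSumFinEquiv.symm (Equiv.refl α)).trans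
      (Equiv.sumArrowEquivProdArrow _ _ _)).trans
      (Equiv.prodCongr ((Equiv.arrowCongr finProdFinEquiv.symm (Equiv.refl α)).trans
        (Equiv.curry _ _ _)) (Equiv.refl _))
  have he : ∀ ω, (e ω).1 = batches h ω := fun ω => by
    funext i j
    rfl
  simp only [← he]
  rw [unifProb_equiv e (fun x => Q x.1)]
  exact unifProb_fst_le Q

lemma pi_measure_ge {n m : ℕ} (ν : Measure (Fin n)) [IsProbabilityMeasure ν]
    (hν : ∀ k, ν {k} = (n : ℝ≥0∞)⁻¹) {P : (Fin m → Fin n) → Prop} {p : ℝ}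
    (h : unifProb (fun ω => ¬ P ω) ≤ p) :
    (Measure.pi fun _ : Fin m => ν) {ω | P ω} ≥ ENNReal.ofReal (1 - p) := by
  rcases Nat.eq_zero_or_pos n with rfl | hn
  · exact absurd (measure_univ (μ := ν)) (by simp [Set.univ_eq_empty_iff.mpr inferInstance])
  have hbad : (Measure.pi fun _ : Fin m => ν) {ω | ¬ P ω}
      = ENNReal.ofReal (unifProb fun ω => ¬ P ω) := by
    have : {ω | ¬ P ω} = ((Finset.univ.filter fun ω => ¬ P ω : Finset (Fin m → Fin n)) :
        Set (Fin m → Fin n)) := by ext; simp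
    rw [this, ← sum_measure_singleton]
    simp only [Measure.pi_singleton, hν, Finset.prod_const, Finset.card_univ, Fintype.card_fin,
      Finset.sum_const, nsmul_eq_mul]
    unfold unifProb
    rw [ENNReal.ofReal_div_of_pos (by simp; positivity), ENNReal.ofReal_natCast,
      ENNReal.ofReal_natCast, ENNReal.div_eq_inv_mul, mul_comm]
    simp only [Fintype.card_pi, Fintype.card_fin, Finset.prod_const, Finset.card_univ,
      Nat.cast_pow, ENNReal.inv_pow]
    congr! 3
    ext
    simp
  have hc : {ω | P ω} = {ω | ¬ P ω}ᶜ := by ext; simp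
  rw [hc, prob_compl_eq_one_sub (Set.toFinite _).measurableSet, hbad, ge_iff_le,
    ENNReal.ofReal_sub _ ((unifProb_nonneg _).trans h), ENNReal.ofReal_one]
  exact tsub_le_tsub_left (ENNReal.ofReal_le_ofReal h) _

section L2

variable {d : ℕ}

lemma l2norm_nonneg (v : Fin d → ℂ) : 0 ≤ l2norm v := Real.sqrt_nonneg _

lemma sq_l2norm (v : Fin d → ℂ) : l2norm v ^ 2 = ∑ i, ‖v i‖ ^ 2 :=
  Real.sq_sqrt (Finset.sum_nonneg fun _ _ => by positivity)

lemma l2norm_eq_norm (v : Fin d → ℂ) : l2norm v = ‖WithLp.toLp 2 v‖ := by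
  rw [EuclideanSpace.norm_eq]; rfl

lemma l2norm_eq_zero {v : Fin d → ℂ} : l2norm v = 0 ↔ v = 0 := by
  rw [l2norm_eq_norm, norm_eq_zero, WithLp.toLp_eq_zero]

lemma l2norm_pos {v : Fin d → ℂ} (hv : v ≠ 0) : 0 < l2norm v :=
  (l2norm_nonneg v).lt_of_ne fun h => hv (l2norm_eq_zero.mp h.symm)

lemma l2norm_smul (c : ℂ) (v : Fin d → ℂ) : l2norm (c • v) = ‖c‖ * l2norm v := by
  rw [l2norm_eq_norm, l2norm_eq_norm, WithLp.toLp_smul, norm_smul]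

lemma l2norm_sub_le (u v : Fin d → ℂ) : l2norm (u - v) ≤ l2norm u + l2norm v := by
  simp only [l2norm_eq_norm, WithLp.toLp_sub]
  exact norm_sub_le _ _

lemma norm_sum_mul_le_sqrt {ι : Type*} (s : Finset ι) (f g : ι → ℂ) :
    ‖∑ i ∈ s, f i * g i‖ ≤ √(∑ i ∈ s, ‖f i‖ ^ 2) * √(∑ i ∈ s, ‖g i‖ ^ 2) := by
  refine (norm_sum_le _ _).trans ?_
  simp only [norm_mul]
  exact Real.sum_mul_le_sqrt_mul_sqrt s _ _

/-- A vector supported on `J` has `ℓ2` norm at most `√|J|` times any bound on its entries. -/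
lemma l2norm_le_of_support {J : Finset (Fin d)} {v : Fin d → ℂ} (hv : ∀ l ∉ J, v l = 0)
    {c : ℝ} (hc : 0 ≤ c) (h : ∀ l ∈ J, ‖v l‖ ≤ c) : l2norm v ≤ √J.card * c := by
  refine Real.sqrt_le_iff.mpr ⟨by positivity, ?_⟩
  rw [mul_pow, Real.sq_sqrt (by positivity), ← nsmul_eq_mul, ← Finset.sum_const,
    ← Finset.sum_subset (Finset.subset_univ J) fun l _ hl => by simp [hv l hl]]
  exact Finset.sum_le_sum fun l hl => pow_le_pow_left₀ (norm_nonneg _) (h l hl) 2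

lemma l1norm_le_of_support {J : Finset (Fin d)} {v : Fin d → ℂ} (hv : ∀ l ∉ J, v l = 0) :
    l1norm v ≤ √J.card * l2norm v := by
  unfold l1norm l2norm
  rw [← Finset.sum_subset (Finset.subset_univ J) fun l _ hl => by simp [hv l hl],
    ← Finset.sum_subset (Finset.subset_univ J) fun l _ hl => by simp [hv l hl]]
  have := Real.sum_mul_le_sqrt_mul_sqrt J (fun _ => (1 : ℝ)) fun l => ‖v l‖
  simpa using this

end L2

section Golfing

variable {n N k : ℕ} (J : Finset (Fin N)) (T : Matrix (Fin N) (Fin n) ℂ)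
  (D : Matrix (Fin n) (Fin N) ℂ)

/-- Deviation, at `q`, of the adjoint of the empirical version of `T * D` from its mean. -/
def batchDev (q : Fin N → ℂ) (b : Fin k → Fin n) (l : Fin N) : ℂ :=
  ((n : ℂ) / k) * ∑ j, star (D (b j) l) * (Tᴴ.mulVec q) (b j) - ((T * D)ᴴ.mulVec q) l

/-- The residual left on `J` by one golfing step. -/
def batchStep (q : Fin N → ℂ) (b : Fin k → Fin n) : Fin N → ℂ :=
  fun l => if l ∈ J then -batchDev T D q b l else 0

/-- The batch `b` does not concentrate well enough to be used at the residual `q`. -/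
def batchBad (σ t : ℝ) (q : Fin N → ℂ) (b : Fin k → Fin n) : Prop :=
  q ≠ 0 ∧ (∀ l ∉ J, q l = 0) ∧
    ((∃ l, 1 / 16 / √J.card * l2norm q ≤ ‖batchDev T D q b l‖) ∨
      2 * σ ^ 2 * l2norm q ^ 2 * (k / n) ≤ ∑ j, ‖(Tᴴ.mulVec q) (b j)‖ ^ 2 ∨
      ∃ i, 2 * ((k : ℝ) / n) + t ≤ ((Finset.univ.filter fun j => b j = i).card : ℝ))

variable {J T D}

lemma l2norm_batchStep_le {q : Fin N → ℂ} {b : Fin k → Fin n} {c : ℝ} (hJ : 0 < J.card)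
    (hc : 0 ≤ c) (h : ∀ l, ‖batchDev T D q b l‖ ≤ c / √J.card) :
    l2norm (batchStep J T D q b) ≤ c := by
  have hs : 0 < √(J.card : ℝ) := Real.sqrt_pos.mpr (by exact_mod_cast hJ)
  have := l2norm_le_of_support (J := J) (v := batchStep J T D q b) (c := c / √J.card)
    (fun l hl => by simp [batchStep, hl]) (by positivity)
    fun l hl => by simpa [batchStep, hl] using h l
  rwa [mul_div_cancel₀ _ hs.ne'] at this

/-- Pairing a residual with a vector in the range of `T`, split into sampled part, deviation and
next residual. -/
lemma star_dotProduct_eq (hT : T * D * T = T) (hD : D * T = 1) (q : Fin N → ℂ)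
    (b : Fin k → Fin n) (h : Fin n → ℂ) :
    star q ⬝ᵥ T.mulVec h
      = ((n : ℂ) / k) * ∑ j, star ((Tᴴ.mulVec q) (b j)) * h (b j)
        - ∑ l ∈ Jᶜ, star (batchDev T D q b l) * T.mulVec h l
        + star (batchStep J T D q b) ⬝ᵥ T.mulVec h := by
  have h1 : star ((T * D)ᴴ.mulVec q) ⬝ᵥ T.mulVec h = star q ⬝ᵥ T.mulVec h := by
    rw [Matrix.star_mulVec, Matrix.conjTranspose_conjTranspose, ← Matrix.dotProduct_mulVec,
      Matrix.mulVec_mulVec, hT]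
  have h2 : ∀ i, ∑ l, D i l * T.mulVec h l = h i := fun i => by
    have : D.mulVec (T.mulVec h) i = h i := by rw [Matrix.mulVec_mulVec, hD, Matrix.one_mulVec]
    exact this
  have h3 : star (batchDev T D q b) ⬝ᵥ T.mulVec h
      = ((n : ℂ) / k) * ∑ j, star ((Tᴴ.mulVec q) (b j)) * h (b j) - star q ⬝ᵥ T.mulVec h := by
    rw [← h1]
    simp only [dotProduct, Pi.star_apply, batchDev, star_sub, sub_mul, Finset.sum_sub_distrib]
    congr 1
    simp only [star_mul', star_sum, star_star, star_div₀, star_natCast, mul_assoc]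
    rw [← Finset.mul_sum]
    congr 1
    simp only [Finset.sum_mul]
    rw [Finset.sum_comm]
    refine Finset.sum_congr rfl fun j _ => ?_
    rw [← h2 (b j), Finset.mul_sum]
    exact Finset.sum_congr rfl fun l _ => by ring
  have h4 : star (batchStep J T D q b) ⬝ᵥ T.mulVec h
      = -∑ l ∈ J, star (batchDev T D q b l) * T.mulVec h l := by
    rw [← Finset.sum_neg_distrib, dotProduct]
    rw [← Finset.sum_subset (Finset.subset_univ J)
      fun l _ hl => by simp [batchStep, hl]]
    exact Finset.sum_congr rfl fun l hl => by simp [batchStep, hl]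
  have h5 : star (batchDev T D q b) ⬝ᵥ T.mulVec h
      = ∑ l ∈ J, star (batchDev T D q b l) * T.mulVec h l
        + ∑ l ∈ Jᶜ, star (batchDev T D q b l) * T.mulVec h l :=
    (Finset.sum_add_sum_compl J _).symm
  rw [h4]
  linear_combination h3 - h5

/-- Samples lying in `W`, each value taken at most `M` times, see at most `M` times the energy
of `h` on `W`. -/
lemma sum_sampled_le {W : Finset (Fin n)} {b : Fin k → Fin n} (hb : ∀ j, b j ∈ W)
    {M : ℝ} (hM : ∀ i, ((Finset.univ.filter fun j => b j = i).card : ℝ) ≤ M) {f : Fin n → ℝ}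
    (hf : ∀ i, 0 ≤ f i) : ∑ j, f (b j) ≤ M * ∑ i ∈ W, f i := by
  rw [← Finset.sum_fiberwise_of_maps_to (s := Finset.univ) (t := W) (g := b)
    (fun j _ => hb j), Finset.mul_sum]
  refine Finset.sum_le_sum fun i _ => ?_
  rw [Finset.sum_congr rfl (g := fun _ => f i)
    fun j hj => by rw [(Finset.mem_filter.mp hj).2], Finset.sum_const, nsmul_eq_mul]
  exact mul_le_mul_of_nonneg_right (hM i) (hf i)

/-- If no golfing stage fails, pairing with a residual is controlled by the samples, up to small
multiples of the two parts of the vector in the range of `T`. -/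
lemma norm_star_dotProduct_le (hT : T * D * T = T) (hD : D * T = 1) (hJ : 0 < J.card)
    (hk : 0 < k) (hn : 0 < n) {σ t E : ℝ} (hE : 0 ≤ E) (ht : 0 ≤ t)
    {W : Finset (Fin n)} {h : Fin n → ℂ} (hh : ∑ i ∈ W, ‖h i‖ ^ 2 ≤ E ^ 2)
    {L : ℕ} {q : Fin N → ℂ} (hq : ∀ l ∉ J, q l = 0) {b : Fin L → Fin k → Fin n}
    (hb : ∀ i j, b i j ∈ W)
    (hgood : ¬ stageFails (batchBad J T D σ t) (batchStep J T D) L q b) :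
    ‖star q ⬝ᵥ T.mulVec h‖ ≤ l2norm q * ((1 / 16) ^ L * √(∑ l ∈ J, ‖T.mulVec h l‖ ^ 2)
      + 16 / 15 * (√(2 * σ ^ 2 * (2 + n * t / k)) * E
        + 1 / 16 / √J.card * ∑ l ∈ Jᶜ, ‖T.mulVec h l‖)) := by
  set z := T.mulVec h with hz
  set B := √(∑ l ∈ J, ‖z l‖ ^ 2)
  set A := ∑ l ∈ Jᶜ, ‖z l‖ with hA
  set K := √(2 * σ ^ 2 * (2 + n * t / k)) * E with hK
  have hA0 : 0 ≤ A := Finset.sum_nonneg fun _ _ => norm_nonneg _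
  have hK0 : 0 ≤ K := by positivity
  have hB0 : 0 ≤ B := Real.sqrt_nonneg _
  induction L generalizing q with
  | zero =>
    have h1 : star q ⬝ᵥ z = ∑ l ∈ J, star (q l) * z l := by
      rw [dotProduct, ← Finset.sum_subset (Finset.subset_univ J)
        fun l _ hl => by simp [hq l hl]]
      rfl
    have h2 : l2norm q = √(∑ l ∈ J, ‖star (q l)‖ ^ 2) := by
      rw [l2norm, ← Finset.sum_subset (Finset.subset_univ J)
        fun l _ hl => by simp [hq l hl]]
      simp
    rw [h1]
    refine (norm_sum_mul_le_sqrt _ _ _).trans ?_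
    rw [← h2]
    have := l2norm_nonneg q
    gcongr
    rw [pow_zero, one_mul]
    exact le_add_of_nonneg_right (by positivity)
  | succ L ih =>
    rcases eq_or_ne q 0 with rfl | hq0
    · have : l2norm (0 : Fin N → ℂ) = 0 := l2norm_eq_zero.mpr rfl
      simp [this]
    rw [stageFails, not_or] at hgood
    obtain ⟨hg, hrest⟩ := hgood
    simp only [batchBad, not_and, not_or, not_exists, not_le] at hg
    obtain ⟨hdev, henergy, hmult⟩ := hg hq0 hq
    have hstep : l2norm (batchStep J T D q (b 0)) ≤ 1 / 16 * l2norm q := by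
      refine l2norm_batchStep_le hJ (by have := l2norm_nonneg q; positivity) fun l => ?_
      calc _ ≤ _ := (hdev l).le
        _ = _ := by ring
    have hnext := ih (q := batchStep J T D q (b 0)) (b := Fin.tail b)
      (fun l hl => by simp [batchStep, hl]) (fun i j => hb _ _) hrest
    have hcompl : ‖∑ l ∈ Jᶜ, star (batchDev T D q (b 0) l) * z l‖
        ≤ 1 / 16 / √J.card * l2norm q * A := by
      refine (norm_sum_le _ _).trans ?_
      rw [hA, Finset.mul_sum]
      refine Finset.sum_le_sum fun l _ => ?_
      rw [norm_mul, norm_star]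
      exact mul_le_mul_of_nonneg_right (hdev l).le (norm_nonneg _)
    have hsamp : ‖((n : ℂ) / k) * ∑ j, star ((Tᴴ.mulVec q) (b 0 j)) * h (b 0 j)‖
        ≤ l2norm q * K := by
      have hk' : (0 : ℝ) < k := by exact_mod_cast hk
      have hn' : (0 : ℝ) < n := by exact_mod_cast hn
      have e1 : ∑ j, ‖star ((Tᴴ.mulVec q) (b 0 j))‖ ^ 2
          ≤ 2 * σ ^ 2 * l2norm q ^ 2 * (k / n) := by
        simpa using henergy.le
      have e2 : ∑ j, ‖h (b 0 j)‖ ^ 2 ≤ (2 * ((k : ℝ) / n) + t) * E ^ 2 :=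
        (sum_sampled_le (hb 0) (fun i => (hmult i).le) (f := fun i => ‖h i‖ ^ 2)
          fun i => by positivity).trans (by gcongr)
      have hc : ‖((n : ℂ) / k)‖ = (n : ℝ) / k := by simp
      rw [norm_mul, hc]
      calc (n : ℝ) / k * ‖∑ j, star ((Tᴴ.mulVec q) (b 0 j)) * h (b 0 j)‖
          ≤ (n : ℝ) / k * (√(2 * σ ^ 2 * l2norm q ^ 2 * (k / n))
              * √((2 * ((k : ℝ) / n) + t) * E ^ 2)) := by
            gcongr
            refine (norm_sum_mul_le_sqrt _ _ _).trans ?_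
            gcongr
        _ = √((n / k) ^ 2 * ((2 * σ ^ 2 * l2norm q ^ 2 * (k / n))
              * ((2 * ((k : ℝ) / n) + t) * E ^ 2))) := by
            rw [Real.sqrt_mul (sq_nonneg ((n : ℝ) / k)), Real.sqrt_sq (by positivity),
              Real.sqrt_mul (x := 2 * σ ^ 2 * l2norm q ^ 2 * (k / n)) (by positivity)]
        _ = √((l2norm q * K) ^ 2) := by
            congr 1
            rw [hK, mul_pow, mul_pow, Real.sq_sqrt (by positivity)]
            field_simp
        _ = l2norm q * K := Real.sqrt_sq (mul_nonneg (l2norm_nonneg q) hK0)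
    rw [star_dotProduct_eq (J := J) hT hD q (b 0) h]
    set P := 16 / 15 * (K + 1 / 16 / √J.card * A) with hP
    have hP0 : 0 ≤ P := by positivity
    calc _ ≤ l2norm q * K + 1 / 16 / √J.card * l2norm q * A
          + l2norm (batchStep J T D q (b 0)) * ((1 / 16) ^ L * B + P) := by
          refine (norm_add_le _ _).trans (add_le_add ((norm_sub_le _ _).trans
            (add_le_add hsamp hcompl)) hnext)
      _ ≤ l2norm q * K + 1 / 16 / √J.card * l2norm q * A
          + 1 / 16 * l2norm q * ((1 / 16) ^ L * B + P) := by gcongr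
      _ = _ := by rw [hP]; ring

end Golfing

/-- Bernstein bound for the empirical total of a real function on `Fin n`. -/
lemma unifProb_dev_le {n k : ℕ} (hn : 0 < n) (hk : 0 < k) {w : Fin n → ℝ} {θ τ v t : ℝ}
    (hθ : 0 < θ) (hw : ∀ i, θ * (n * |w i|) ≤ 1) (hv : ∑ i, w i ^ 2 ≤ v)
    (ht : t ≤ k * (θ * τ - θ ^ 2 * (n * v))) :
    unifProb (fun b : Fin k → Fin n => τ ≤ (n : ℝ) / k * ∑ j, w (b j) - ∑ i, w i)
      ≤ Real.exp (-t) := by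
  have hk' : (0 : ℝ) < k := by exact_mod_cast hk
  have hn' : (0 : ℝ) < n := by exact_mod_cast hn
  refine (unifProb_mono fun b hb => ?_).trans
    (unifProb_chernoff (m := k) (g := fun i => θ * (n * w i))
      (w := θ * ∑ i, w i + θ ^ 2 * (n * v)) (fun i => ?_) t ?_)
  · have h1 : k * (τ + ∑ i, w i) ≤ n * ∑ j, w (b j) := by
      have : (n : ℝ) / k * ∑ j, w (b j) = (n * ∑ j, w (b j)) / k := by ring
      rw [this, le_sub_iff_add_le, le_div_iff₀ hk'] at hb
      linarith
    have h2 := mul_le_mul_of_nonneg_left h1 hθ.le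
    have h3 : ∑ j, θ * (n * w (b j)) = θ * (n * ∑ j, w (b j)) := by
      rw [Finset.mul_sum, Finset.mul_sum]
    rw [h3]
    linarith
  · rw [abs_mul, abs_mul, abs_of_pos hθ, abs_of_pos hn']
    exact hw i
  · have h1 : ∑ i, (θ * (n * w i) + (θ * (n * w i)) ^ 2)
        = n * (θ * ∑ i, w i + θ ^ 2 * (n * ∑ i, w i ^ 2)) := by
      simp only [Finset.mul_sum, mul_add, Finset.sum_add_distrib]
      congr 1 <;> exact Finset.sum_congr rfl fun i _ => by ring
    rw [h1]
    gcongr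

lemma unifProb_norm_dev_le {n k : ℕ} (hn : 0 < n) (hk : 0 < k) {ζ : Fin n → ℂ} {θ τ v t : ℝ}
    (hθ : 0 < θ) (hζ : ∀ i, θ * (n * ‖ζ i‖) ≤ 1) (hv : ∑ i, ‖ζ i‖ ^ 2 ≤ v)
    (ht : t ≤ k * (θ * τ - θ ^ 2 * (n * v))) :
    unifProb (fun b : Fin k → Fin n => 2 * τ ≤ ‖(n : ℂ) / k * ∑ j, ζ (b j) - ∑ i, ζ i‖)
      ≤ 4 * Real.exp (-t) := by
  have main : ∀ w : Fin n → ℝ, (∀ i, |w i| ≤ ‖ζ i‖) →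
      unifProb (fun b : Fin k → Fin n => τ ≤ (n : ℝ) / k * ∑ j, w (b j) - ∑ i, w i)
        ≤ Real.exp (-t) := fun w hw => by
    refine unifProb_dev_le hn hk hθ (v := v) (fun i => ?_) ?_ ht
    · refine le_trans ?_ (hζ i)
      have := hw i
      gcongr
    · refine le_trans (Finset.sum_le_sum fun i _ => ?_) hv
      rw [← sq_abs]
      exact pow_le_pow_left₀ (abs_nonneg _) (hw i) 2
  have hre := main (fun i => (ζ i).re) fun i => Complex.abs_re_le_norm _
  have hre' := main (fun i => -(ζ i).re) fun i => by
    rw [abs_neg]; exact Complex.abs_re_le_norm _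
  have him := main (fun i => (ζ i).im) fun i => Complex.abs_im_le_norm _
  have him' := main (fun i => -(ζ i).im) fun i => by
    rw [abs_neg]; exact Complex.abs_im_le_norm _
  have hcover := unifProb_mono (α := Fin k → Fin n)
    (P := fun b => 2 * τ ≤ ‖(n : ℂ) / k * ∑ j, ζ (b j) - ∑ i, ζ i‖)
    (Q := fun b => (τ ≤ (n : ℝ) / k * ∑ j, (ζ (b j)).re - ∑ i, (ζ i).re ∨
      τ ≤ (n : ℝ) / k * ∑ j, -(ζ (b j)).re - ∑ i, -(ζ i).re) ∨
      (τ ≤ (n : ℝ) / k * ∑ j, (ζ (b j)).im - ∑ i, (ζ i).im ∨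
      τ ≤ (n : ℝ) / k * ∑ j, -(ζ (b j)).im - ∑ i, -(ζ i).im)) fun b hb => by
    have hc : (n : ℂ) / k = ((n / k : ℝ) : ℂ) := by push_cast; rfl
    have h1 := hb.trans (Complex.norm_le_abs_re_add_abs_im _)
    rw [hc, Complex.sub_re, Complex.sub_im, Complex.re_ofReal_mul, Complex.im_ofReal_mul,
      Complex.re_sum, Complex.re_sum, Complex.im_sum, Complex.im_sum] at h1
    simp only [Finset.sum_neg_distrib]
    by_contra! hcon
    obtain ⟨⟨a1, a2⟩, a3, a4⟩ := hcon
    have r1 := abs_lt.mpr ⟨by linarith, a1⟩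
    have r2 := abs_lt.mpr ⟨by linarith, a3⟩
    linarith
  have u1 := unifProb_or_le
    (fun b : Fin k → Fin n => τ ≤ (n : ℝ) / k * ∑ j, (ζ (b j)).re - ∑ i, (ζ i).re)
    fun b => τ ≤ (n : ℝ) / k * ∑ j, -(ζ (b j)).re - ∑ i, -(ζ i).re
  have u2 := unifProb_or_le
    (fun b : Fin k → Fin n => τ ≤ (n : ℝ) / k * ∑ j, (ζ (b j)).im - ∑ i, (ζ i).im)
    fun b => τ ≤ (n : ℝ) / k * ∑ j, -(ζ (b j)).im - ∑ i, -(ζ i).im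
  have u3 := hcover.trans (unifProb_or_le _ _)
  linarith

section BatchBad

variable {n N k : ℕ} {J : Finset (Fin N)} {T : Matrix (Fin N) (Fin n) ℂ}
  {D : Matrix (Fin n) (Fin N) ℂ}

lemma norm_conjTranspose_mulVec_le {α : ℝ} (hα : ∀ i j, ‖T i j‖ ≤ α) {q : Fin N → ℂ}
    (hα0 : 0 ≤ α) (hq : ∀ l ∉ J, q l = 0) (i : Fin n) :
    ‖Tᴴ.mulVec q i‖ ≤ α * (√J.card * l2norm q) := by
  calc ‖Tᴴ.mulVec q i‖ ≤ ∑ l, ‖Tᴴ i l * q l‖ :=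
        norm_sum_le Finset.univ fun l => Tᴴ i l * q l
    _ ≤ ∑ l, α * ‖q l‖ := Finset.sum_le_sum fun l _ => by
        rw [norm_mul, Matrix.conjTranspose_apply, norm_star]
        exact mul_le_mul_of_nonneg_right (hα l i) (norm_nonneg _)
    _ = α * l1norm q := by rw [← Finset.mul_sum]; rfl
    _ ≤ _ := by gcongr; exact l1norm_le_of_support hq

lemma batchDev_eq (q : Fin N → ℂ) (b : Fin k → Fin n) (l : Fin N) :
    batchDev T D q b l = (n : ℂ) / k * ∑ j, star (D (b j) l) * Tᴴ.mulVec q (b j)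
      - ∑ i, star (D i l) * Tᴴ.mulVec q i := by
  have : (T * D)ᴴ.mulVec q l = ∑ i, star (D i l) * Tᴴ.mulVec q i := by
    rw [Matrix.conjTranspose_mul, ← Matrix.mulVec_mulVec]
    rfl
  rw [batchDev, this]

lemma unifProb_batchBad_le (hn : 0 < n) (hk : 0 < k) (hJ : 0 < J.card) {α β σ μ t : ℝ}
    (hα0 : 0 ≤ α) (hβ0 : 0 ≤ β) (hσ0 : 0 < σ) (hμ0 : 0 < μ)
    (hα : ∀ i j, ‖T i j‖ ≤ α) (hβ : ∀ i j, ‖D i j‖ ≤ β)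
    (hσ : ∀ q : Fin N → ℂ, ∑ i, ‖Tᴴ.mulVec q i‖ ^ 2 ≤ σ ^ 2 * l2norm q ^ 2)
    (hαβ : n * (α * β) ≤ μ) (hασ : n * α ^ 2 ≤ μ * σ ^ 2) (hβσ : n * (β ^ 2 * σ ^ 2) ≤ 2 * μ)
    (ht : 8192 * (μ * J.card) * t ≤ k) (q : Fin N → ℂ) :
    unifProb (batchBad (k := k) J T D σ t q) ≤ (4 * N + 1 + n) * Real.exp (-t) := by
  by_cases hq0 : q = 0
  · have : unifProb (batchBad (k := k) J T D σ t q) = 0 := by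
      simp [unifProb, batchBad, hq0]
    rw [this]; positivity
  by_cases hq : ∀ l ∉ J, q l = 0
  swap
  · have : unifProb (batchBad (k := k) J T D σ t q) = 0 := by
      simp [unifProb, batchBad, hq]
    rw [this]; positivity
  have hk' : (0 : ℝ) < k := by exact_mod_cast hk
  have hn' : (0 : ℝ) < n := by exact_mod_cast hn
  have hJ' : (0 : ℝ) < J.card := by exact_mod_cast hJ
  have hs : 0 < √(J.card : ℝ) := Real.sqrt_pos.mpr hJ'
  have hss : √(J.card : ℝ) ^ 2 = J.card := Real.sq_sqrt hJ'.le
  have hQ : 0 < l2norm q := l2norm_pos hq0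
  have hTq := norm_conjTranspose_mulVec_le hα hα0 hq
  set Q := l2norm q with hQdef
  set r := √(J.card : ℝ) with hr
  have hcard : 8192 * (μ * r ^ 2) * t ≤ k := by rw [hss]; exact ht
  have hdev : ∀ l, unifProb (fun b : Fin k → Fin n => 1 / 16 / r * Q ≤ ‖batchDev T D q b l‖)
      ≤ 4 * Real.exp (-t) := fun l => by
    have h1 := unifProb_norm_dev_le (k := k) hn hk
      (ζ := fun i => star (D i l) * Tᴴ.mulVec q i)
      (θ := 1 / (128 * (μ * r * Q))) (τ := 1 / 32 / r * Q) (v := β ^ 2 * (σ ^ 2 * Q ^ 2)) (t := t)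
      (by positivity) (fun i => ?_) ?_ ?_
    · refine (unifProb_mono fun b hb => ?_).trans h1
      rw [batchDev_eq] at hb
      refine le_trans (le_of_eq ?_) hb
      ring
    · rw [norm_mul, norm_star, one_div_mul_eq_div, div_le_one (by positivity)]
      calc n * (‖D i l‖ * ‖Tᴴ.mulVec q i‖) ≤ n * (β * (α * (r * Q))) := by
            gcongr
            exacts [hβ i l, hTq i]
        _ = n * (α * β) * (r * Q) := by ring
        _ ≤ μ * (r * Q) := by gcongr
        _ ≤ 128 * (μ * r * Q) := by nlinarith [mul_pos (mul_pos hμ0 hs) hQ]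
    · calc ∑ i, ‖star (D i l) * Tᴴ.mulVec q i‖ ^ 2 ≤ ∑ i, β ^ 2 * ‖Tᴴ.mulVec q i‖ ^ 2 := by
            refine Finset.sum_le_sum fun i _ => ?_
            rw [norm_mul, norm_star, mul_pow]
            gcongr
            exact hβ i l
        _ ≤ _ := by rw [← Finset.mul_sum]; gcongr; exact hσ q
    · have h2 : n * (β ^ 2 * (σ ^ 2 * Q ^ 2)) ≤ 2 * μ * Q ^ 2 := by
        calc _ = n * (β ^ 2 * σ ^ 2) * Q ^ 2 := by ring
          _ ≤ _ := by gcongr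
      calc t ≤ k * (1 / (8192 * (μ * r ^ 2))) := by
            rw [mul_one_div, le_div_iff₀ (by positivity)]; linarith
        _ = k * (1 / (128 * (μ * r * Q)) * (1 / 32 / r * Q)
            - (1 / (128 * (μ * r * Q))) ^ 2 * (2 * μ * Q ^ 2)) := by field_simp; norm_num
        _ ≤ _ := by gcongr
  have henergy : unifProb (fun b : Fin k → Fin n =>
      2 * σ ^ 2 * Q ^ 2 * (k / n) ≤ ∑ j, ‖(Tᴴ.mulVec q) (b j)‖ ^ 2) ≤ Real.exp (-t) := by
    have hmax : ∀ i, n * ‖Tᴴ.mulVec q i‖ ^ 2 ≤ μ * r ^ 2 * (σ ^ 2 * Q ^ 2) := fun i => by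
      calc n * ‖Tᴴ.mulVec q i‖ ^ 2 ≤ n * (α * (r * Q)) ^ 2 := by gcongr; exact hTq i
        _ = n * α ^ 2 * (r ^ 2 * Q ^ 2) := by ring
        _ ≤ μ * σ ^ 2 * (r ^ 2 * Q ^ 2) := by gcongr
        _ = _ := by ring
    have hmean := hσ q
    have h1 := unifProb_dev_le (k := k) hn hk
      (w := fun i => ‖Tᴴ.mulVec q i‖ ^ 2) (θ := 1 / (2 * (μ * r ^ 2 * (σ ^ 2 * Q ^ 2))))
      (τ := 2 * σ ^ 2 * Q ^ 2 - ∑ i, ‖Tᴴ.mulVec q i‖ ^ 2)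
      (v := μ * r ^ 2 * (σ ^ 2 * Q ^ 2) / n * (σ ^ 2 * Q ^ 2)) (t := t)
      (by positivity) (fun i => ?_) ?_ ?_
    · refine (unifProb_mono fun b hb => ?_).trans h1
      have : (n : ℝ) / k * (2 * σ ^ 2 * Q ^ 2 * (k / n)) = 2 * σ ^ 2 * Q ^ 2 := by field_simp
      rw [sub_le_sub_iff_right, ← this]
      gcongr
    · rw [abs_of_nonneg (by positivity), one_div_mul_eq_div, div_le_one (by positivity)]
      exact (hmax i).trans (by
        have : 0 < μ * r ^ 2 * (σ ^ 2 * Q ^ 2) := by positivity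
        linarith)
    · calc ∑ i, (‖Tᴴ.mulVec q i‖ ^ 2) ^ 2
          ≤ ∑ i, μ * r ^ 2 * (σ ^ 2 * Q ^ 2) / n * ‖Tᴴ.mulVec q i‖ ^ 2 := by
            refine Finset.sum_le_sum fun i _ => ?_
            rw [sq (‖Tᴴ.mulVec q i‖ ^ 2)]
            gcongr
            rw [le_div_iff₀ hn', mul_comm]
            exact hmax i
        _ ≤ _ := by rw [← Finset.mul_sum]; gcongr
    · calc t ≤ k * (1 / (8192 * (μ * r ^ 2))) := by
            rw [mul_one_div, le_div_iff₀ (by positivity)]; linarith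
        _ ≤ k * (1 / (4 * (μ * r ^ 2))) := by gcongr; norm_num
        _ = k * (1 / (2 * (μ * r ^ 2 * (σ ^ 2 * Q ^ 2))) * (σ ^ 2 * Q ^ 2)
            - (1 / (2 * (μ * r ^ 2 * (σ ^ 2 * Q ^ 2)))) ^ 2
              * (n * (μ * r ^ 2 * (σ ^ 2 * Q ^ 2) / n * (σ ^ 2 * Q ^ 2)))) := by
            field_simp; norm_num
        _ ≤ _ := by gcongr; linarith
  have hmult : ∀ i : Fin n, unifProb (fun b : Fin k → Fin n =>
      2 * ((k : ℝ) / n) + t ≤ ((Finset.univ.filter fun j => b j = i).card : ℝ))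
      ≤ Real.exp (-t) := fun i => by
    refine (unifProb_mono fun b hb => ?_).trans (unifProb_chernoff (m := k)
      (g := fun i' => if i' = i then 1 else 0) (w := 2 / n) (fun i' => ?_) t ?_)
    · simp only [Finset.sum_boole]
      refine le_trans (le_of_eq ?_) hb
      ring
    · split_ifs <;> simp
    · have : ∀ i', ((if i' = i then 1 else 0 : ℝ) + (if i' = i then 1 else 0 : ℝ) ^ 2)
          = if i' = i then 2 else 0 := fun i' => by split_ifs <;> norm_num
      simp only [this, Finset.sum_ite_eq', Finset.mem_univ, if_true]
      rw [mul_div_cancel₀ _ hn'.ne']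
  have u1 := unifProb_exists_le _ hdev
  have u2 := unifProb_exists_le _ hmult
  have u3 := unifProb_or_le (fun b : Fin k → Fin n =>
    2 * σ ^ 2 * Q ^ 2 * (k / n) ≤ ∑ j, ‖(Tᴴ.mulVec q) (b j)‖ ^ 2) (fun b => ∃ i : Fin n,
      2 * ((k : ℝ) / n) + t ≤ ((Finset.univ.filter fun j => b j = i).card : ℝ))
  have u4 := unifProb_or_le (fun b : Fin k → Fin n =>
    ∃ l, 1 / 16 / r * Q ≤ ‖batchDev T D q b l‖) (fun b =>
    2 * σ ^ 2 * Q ^ 2 * (k / n) ≤ ∑ j, ‖(Tᴴ.mulVec q) (b j)‖ ^ 2 ∨ ∃ i : Fin n,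
      2 * ((k : ℝ) / n) + t ≤ ((Finset.univ.filter fun j => b j = i).card : ℝ))
  have u5 : unifProb (batchBad (k := k) J T D σ t q) ≤ _ :=
    (unifProb_mono fun b hb => hb.2.2).trans u4
  simp only [Fintype.card_fin] at u1 u2
  linarith

end BatchBad

section Spectral

variable {d e : ℕ}

lemma specNorm_nonneg (A : Matrix (Fin d) (Fin e) ℂ) : 0 ≤ specNorm A := norm_nonneg _

lemma l2norm_mulVec_le (A : Matrix (Fin d) (Fin e) ℂ) (v : Fin e → ℂ) :
    l2norm (A.mulVec v) ≤ specNorm A * l2norm v := by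
  rw [l2norm_eq_norm, l2norm_eq_norm]
  exact (LinearMap.toContinuousLinearMap (Matrix.toEuclideanLin A)).le_opNorm (WithLp.toLp 2 v)

lemma specNorm_le {A : Matrix (Fin d) (Fin e) ℂ} {c : ℝ} (hc : 0 ≤ c)
    (h : ∀ v, l2norm (A.mulVec v) ≤ c * l2norm v) : specNorm A ≤ c := by
  refine ContinuousLinearMap.opNorm_le_bound _ hc fun v => ?_
  have := h v.ofLp
  rwa [l2norm_eq_norm, l2norm_eq_norm] at this

lemma norm_star_dotProduct_le_l2norm (u v : Fin d → ℂ) :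
    ‖star u ⬝ᵥ v‖ ≤ l2norm u * l2norm v := by
  have := norm_sum_mul_le_sqrt Finset.univ (star u) v
  simpa [l2norm, dotProduct] using this

lemma star_dotProduct_self (v : Fin d → ℂ) : star v ⬝ᵥ v = ((l2norm v ^ 2 : ℝ) : ℂ) := by
  rw [sq_l2norm, dotProduct]
  push_cast
  exact Finset.sum_congr rfl fun i _ => by
    rw [Pi.star_apply, RCLike.star_def, Complex.conj_mul']

lemma star_dotProduct_gram (T : Matrix (Fin d) (Fin e) ℂ) (γ : ℝ) (v : Fin e → ℂ) :
    star v ⬝ᵥ ((γ : ℂ) • (Tᴴ * T) - 1).mulVec v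
      = ((γ * l2norm (T.mulVec v) ^ 2 - l2norm v ^ 2 : ℝ) : ℂ) := by
  rw [Matrix.sub_mulVec, Matrix.one_mulVec, dotProduct_sub, Matrix.smul_mulVec, dotProduct_smul,
    ← Matrix.mulVec_mulVec, Matrix.dotProduct_mulVec, ← Matrix.star_mulVec, star_dotProduct_self,
    star_dotProduct_self]
  push_cast
  rfl

lemma abs_gram_sub_le (T : Matrix (Fin d) (Fin e) ℂ) (γ : ℝ) (v : Fin e → ℂ) :
    |γ * l2norm (T.mulVec v) ^ 2 - l2norm v ^ 2|
      ≤ specNorm ((γ : ℂ) • (Tᴴ * T) - 1) * l2norm v ^ 2 := by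
  rw [← Real.norm_eq_abs, ← Complex.norm_real, ← star_dotProduct_gram]
  refine (norm_star_dotProduct_le_l2norm _ _).trans ?_
  have := l2norm_mulVec_le ((γ : ℂ) • (Tᴴ * T) - 1) v
  have h0 := l2norm_nonneg v
  nlinarith

lemma opNorm_le_of_isSymmetric {E : Type*} [NormedAddCommGroup E] [InnerProductSpace ℂ E]
    {A : E →L[ℂ] E} (hA : A.IsSymmetric) {c : ℝ} (hc : 0 ≤ c)
    (h : ∀ v, ‖inner ℂ v (A v)‖ ≤ c * ‖v‖ ^ 2) : ‖A‖ ≤ c := by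
  rw [ContinuousLinearMap.norm_eq_iSup_rayleighQuotient A hA]
  refine ciSup_le fun v => ?_
  rw [ContinuousLinearMap.rayleighQuotient, abs_div, abs_of_nonneg (sq_nonneg ‖v‖)]
  refine div_le_of_le_mul₀ (by positivity) hc ?_
  refine le_trans ?_ (h v)
  rw [ContinuousLinearMap.reApplyInnerSelf_apply, ← inner_conj_symm, RCLike.conj_re]
  exact Complex.abs_re_le_norm _

lemma specNorm_le_of_isHermitian {A : Matrix (Fin d) (Fin d) ℂ} (hA : A.IsHermitian) {c : ℝ}
    (hc : 0 ≤ c) (h : ∀ v, ‖star v ⬝ᵥ A.mulVec v‖ ≤ c * l2norm v ^ 2) : specNorm A ≤ c := by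
  refine opNorm_le_of_isSymmetric (Matrix.isSymmetric_toEuclideanLin_iff.mpr hA) hc fun v => ?_
  have h1 := h v.ofLp
  rw [l2norm_eq_norm] at h1
  rwa [EuclideanSpace.inner_eq_star_dotProduct, dotProduct_comm,
    LinearMap.coe_toContinuousLinearMap', Matrix.ofLp_toLpLin, Matrix.toLin'_apply]

lemma specNorm_gram_le (T : Matrix (Fin d) (Fin e) ℂ) (γ : ℝ) {c : ℝ}
    (h : ∀ v, |γ * l2norm (T.mulVec v) ^ 2 - l2norm v ^ 2| ≤ c * l2norm v ^ 2) (hc : 0 ≤ c) :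
    specNorm ((γ : ℂ) • (Tᴴ * T) - 1) ≤ c := by
  refine specNorm_le_of_isHermitian ?_ hc fun v => ?_
  · rw [Matrix.IsHermitian, Matrix.conjTranspose_sub, Matrix.conjTranspose_smul,
      Matrix.conjTranspose_mul, Matrix.conjTranspose_conjTranspose, Matrix.conjTranspose_one]
    simp
  · rw [star_dotProduct_gram, Complex.norm_real]
    exact h v

lemma conjTranspose_l2norm_le (T : Matrix (Fin d) (Fin e) ℂ) (q : Fin d → ℂ) :
    l2norm (Tᴴ.mulVec q) ≤ specNorm T * l2norm q := by
  have h1 : l2norm (Tᴴ.mulVec q) ^ 2 ≤ l2norm q * (specNorm T * l2norm (Tᴴ.mulVec q)) := by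
    have h2 : star (Tᴴ.mulVec q) ⬝ᵥ Tᴴ.mulVec q = star q ⬝ᵥ T.mulVec (Tᴴ.mulVec q) := by
      rw [Matrix.dotProduct_mulVec (star q), Matrix.star_mulVec,
        Matrix.conjTranspose_conjTranspose]
    have h3 := norm_star_dotProduct_le_l2norm q (T.mulVec (Tᴴ.mulVec q))
    rw [← h2, star_dotProduct_self, Complex.norm_real, Real.norm_of_nonneg (by positivity)] at h3
    exact h3.trans (mul_le_mul_of_nonneg_left (l2norm_mulVec_le _ _) (l2norm_nonneg _))
  rcases (l2norm_nonneg (Tᴴ.mulVec q)).eq_or_lt with h0 | h0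
  · rw [← h0]
    exact mul_nonneg (specNorm_nonneg _) (l2norm_nonneg _)
  · nlinarith

lemma sigmaMin_mul_le (T : Matrix (Fin d) (Fin e) ℂ) (v : Fin e → ℂ) :
    sigmaMin T * l2norm v ≤ l2norm (T.mulVec v) := by
  by_cases hv : v = 0
  · subst hv
    simp [l2norm]
  have hpos := l2norm_pos hv
  rw [← le_div_iff₀ hpos]
  refine csInf_le ⟨0, ?_⟩ ⟨((l2norm v)⁻¹ : ℂ) • v, ?_, ?_⟩
  · rintro r ⟨u, -, rfl⟩
    exact l2norm_nonneg _
  · rw [l2norm_smul, norm_inv, Complex.norm_real, Real.norm_of_nonneg hpos.le,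
      inv_mul_cancel₀ hpos.ne']
  · rw [Matrix.mulVec_smul, l2norm_smul, norm_inv, Complex.norm_real,
      Real.norm_of_nonneg hpos.le]
    ring

lemma le_sigmaMin {T : Matrix (Fin d) (Fin e) ℂ} (he : 0 < e) {c : ℝ}
    (h : ∀ v, l2norm v = 1 → c ≤ l2norm (T.mulVec v)) : c ≤ sigmaMin T := by
  refine le_csInf ⟨_, Pi.single ⟨0, he⟩ 1, ?_, rfl⟩ ?_
  · simp [l2norm, Pi.single_apply, apply_ite]
  · rintro r ⟨u, hu, rfl⟩
    exact h u hu

lemma sigmaMin_pos {T : Matrix (Fin d) (Fin e) ℂ} {D : Matrix (Fin e) (Fin d) ℂ} (he : 0 < e)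
    (hD : D * T = 1) : 0 < sigmaMin T := by
  have h1 : (0 : ℝ) < 1 / (specNorm D + 1) := by
    have := specNorm_nonneg D
    positivity
  refine h1.trans_le (le_sigmaMin he fun v hv => ?_)
  have h2 := l2norm_mulVec_le D (T.mulVec v)
  rw [Matrix.mulVec_mulVec, hD, Matrix.one_mulVec, hv] at h2
  rw [div_le_iff₀ (by have := specNorm_nonneg D; positivity)]
  nlinarith [l2norm_nonneg (T.mulVec v)]

lemma sigmaMin_le_sigmaMax {T : Matrix (Fin d) (Fin e) ℂ} (he : 0 < e) :
    sigmaMin T ≤ sigmaMax T := by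
  have h1 : l2norm (Pi.single (⟨0, he⟩ : Fin e) (1 : ℂ)) = 1 := by
    simp [l2norm, Pi.single_apply, apply_ite]
  have := (sigmaMin_mul_le T _).trans (l2norm_mulVec_le T (Pi.single (⟨0, he⟩ : Fin e) (1 : ℂ)))
  rwa [h1, mul_one, mul_one] at this

lemma balancing_mul_sq_le {T : Matrix (Fin d) (Fin e) ℂ} {γ : ℝ} (hγ : 0 < γ)
    (hδ : specNorm ((γ : ℂ) • (Tᴴ * T) - 1) < 1) : γ * sigmaMax T ^ 2 ≤ 2 := by
  have h1 : sigmaMax T ≤ √(2 / γ) := by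
    refine specNorm_le (by positivity) fun v => ?_
    have h2 := (abs_le.mp (abs_gram_sub_le T γ v)).2
    have h3 : l2norm (T.mulVec v) ^ 2 ≤ 2 / γ * l2norm v ^ 2 := by
      rw [div_mul_eq_mul_div, le_div_iff₀ hγ]
      nlinarith [sq_nonneg (l2norm v)]
    rw [← Real.sqrt_sq (l2norm_nonneg v), ← Real.sqrt_mul (by positivity)]
    exact Real.le_sqrt_of_sq_le h3
  have h2 := pow_le_pow_left₀ (specNorm_nonneg T) h1 2
  rw [Real.sq_sqrt (by positivity), le_div_iff₀ hγ] at h2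
  rw [sigmaMax]
  linarith

lemma one_le_balancing_mul_sq {T : Matrix (Fin d) (Fin e) ℂ} {γ : ℝ} (he : 0 < e)
    (hmin : 0 < sigmaMin T) (hγ : IsBalancing T γ) : 1 ≤ γ * sigmaMax T ^ 2 := by
  by_contra! hlt
  have hσ : 0 < sigmaMax T := hmin.trans_le (sigmaMin_le_sigmaMax he)
  set γ' := 1 / sigmaMax T ^ 2 with hγ'
  have hγ'0 : 0 < γ' := by positivity
  have hγγ' : γ < γ' := by rwa [hγ', lt_div_iff₀ (by positivity)]
  have h1 : specNorm ((γ' : ℂ) • (Tᴴ * T) - 1) ≤ 1 - γ' * sigmaMin T ^ 2 := by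
    refine specNorm_gram_le T γ' (fun v => ?_) ?_
    · have a1 := l2norm_mulVec_le T v
      have a2 := sigmaMin_mul_le T v
      have a3 := pow_le_pow_left₀ (l2norm_nonneg _) a1 2
      have a4 := pow_le_pow_left₀ (mul_nonneg hmin.le (l2norm_nonneg v)) a2 2
      have a5 : γ' * l2norm (T.mulVec v) ^ 2 ≤ l2norm v ^ 2 := by
        rw [hγ', one_div_mul_eq_div, div_le_iff₀ (by positivity)]
        calc _ ≤ _ := a3
          _ = _ := by rw [mul_pow, sigmaMax]; ring
      have a6 := mul_le_mul_of_nonneg_left a4 hγ'0.le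
      rw [abs_of_nonpos (by linarith)]
      rw [mul_pow] at a6
      linarith
    · rw [sub_nonneg, hγ', one_div_mul_eq_div, div_le_one (by positivity)]
      exact pow_le_pow_left₀ hmin.le (sigmaMin_le_sigmaMax he) 2
  have h2 := (hγ.2 γ' hγ'0).trans h1
  have h3 : √(γ' / γ) * sigmaMin T ≤ sigmaMin T := by
    refine le_sigmaMin he fun v hv => ?_
    have b1 := (abs_le.mp (abs_gram_sub_le T γ v)).1
    rw [hv] at b1
    have hγ0 := hγ.1
    refine le_of_sq_le_sq ?_ (l2norm_nonneg _)
    rw [mul_pow, Real.sq_sqrt (by positivity), div_mul_eq_mul_div, div_le_iff₀ hγ0]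
    linarith
  have h4 : 1 < √(γ' / γ) := by
    rw [Real.lt_sqrt (by norm_num), one_pow, lt_div_iff₀ hγ.1]
    linarith
  nlinarith

end Spectral

section Incoherence

variable {n N : ℕ} {T : Matrix (Fin N) (Fin n) ℂ} {D : Matrix (Fin n) (Fin N) ℂ}

lemma norm_entry_le_of_locIncoh_le {A : Matrix (Fin N) (Fin n) ℂ} {γ μ : ℝ} (hn : 0 < n)
    (hγ : 0 < γ) {k : Fin n} (h : locIncoh γ A k ≤ μ) (i : Fin N) : ‖A i k‖ ≤ √(μ / (n * γ)) := by
  refine Real.le_sqrt_of_sq_le ?_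
  rw [le_div_iff₀ (by positivity)]
  have h1 : ‖A i k‖ ≤ linfnorm fun i => A i k :=
    le_ciSup (f := fun i => ‖A i k‖) (Set.finite_range _).bddAbove i
  calc ‖A i k‖ ^ 2 * (n * γ) ≤ (linfnorm fun i => A i k) ^ 2 * (n * γ) := by gcongr
    _ = locIncoh γ A k := by rw [locIncoh]; ring
    _ ≤ μ := h

lemma max_locIncoh_le_incoherence (γ : ℝ) (A B : Matrix (Fin N) (Fin n) ℂ) (k : Fin n) :
    max (locIncoh γ A k) (locIncoh γ⁻¹ B k) ≤ incoherence γ A B :=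
  le_ciSup (f := fun k => max (locIncoh γ A k) (locIncoh γ⁻¹ B k)) (Set.finite_range _).bddAbove k

lemma incoherence_nonneg {γ : ℝ} (hγ : 0 < γ) (A B : Matrix (Fin N) (Fin n) ℂ) :
    0 ≤ incoherence γ A B :=
  Real.iSup_nonneg fun k => le_max_of_le_left (by unfold locIncoh; positivity)

lemma left_inverse_of_injective (hinj : Function.Injective T.mulVec) (hT : T * D * T = T) :
    D * T = 1 := by
  refine Matrix.ext_of_mulVec_single fun i => hinj ?_
  rw [Matrix.mulVec_mulVec, ← Matrix.mul_assoc, hT, Matrix.one_mulVec]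

lemma card_le_of_injective (hinj : Function.Injective T.mulVec) : n ≤ N := by
  have := LinearMap.finrank_le_finrank_of_injective (f := T.mulVecLin) hinj
  simpa using this

lemma norm_mul_entry_le {α β : ℝ} (hα0 : 0 ≤ α) (hα : ∀ i j, ‖T i j‖ ≤ α)
    (hβ : ∀ i j, ‖D i j‖ ≤ β) (l l' : Fin N) : ‖(T * D) l l'‖ ≤ n * (α * β) := by
  rw [Matrix.mul_apply]
  refine (norm_sum_le_of_le (f := fun j => T l j * D j l') Finset.univ (n := fun _ => α * β)
    fun j _ => ?_).trans (by simp)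
  rw [norm_mul]
  exact mul_le_mul (hα _ _) (hβ _ _) (norm_nonneg _) hα0

lemma card_le_mul_of_norm_mul_entry_le (hD : D * T = 1) {μ : ℝ}
    (h : ∀ l, ‖(T * D) l l‖ ≤ μ) : (n : ℝ) ≤ N * μ := by
  have h1 : (T * D).trace = n := by rw [Matrix.trace_mul_comm, hD, Matrix.trace_one]; simp
  have h2 : (n : ℝ) = ‖(T * D).trace‖ := by rw [h1, Complex.norm_natCast]
  rw [h2, Matrix.trace]
  refine (norm_sum_le_of_le Finset.univ (n := fun _ => μ) fun l _ => h l).trans (by simp)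

lemma one_le_mul_card_of_mulVec_eq {P : Matrix (Fin N) (Fin N) ℂ} {μ : ℝ}
    (hP : ∀ l l', ‖P l l'‖ ≤ μ) {y : Fin N → ℂ} (hy : P.mulVec y = y) (hy0 : y ≠ 0)
    {J : Finset (Fin N)} (hJ : ∀ l ∉ J, y l = 0) : 1 ≤ μ * J.card := by
  obtain ⟨l₀, hl₀⟩ := Function.ne_iff.mp hy0
  obtain ⟨l, -, hl⟩ := Finset.exists_max_image Finset.univ (fun l => ‖y l‖) ⟨l₀, Finset.mem_univ _⟩
  have hpos : 0 < ‖y l‖ := (norm_pos_iff.mpr hl₀).trans_le (hl l₀ (Finset.mem_univ _))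
  have h1 : ‖y l‖ ≤ μ * J.card * ‖y l‖ := by
    calc ‖y l‖ = ‖∑ l', P l l' * y l'‖ := by conv_lhs => rw [← hy, Matrix.mulVec, dotProduct]
      _ = ‖∑ l' ∈ J, P l l' * y l'‖ := by
          rw [Finset.sum_subset (Finset.subset_univ J) fun l' _ hl' => by simp [hJ l' hl']]
      _ ≤ ∑ _l' ∈ J, μ * ‖y l‖ := norm_sum_le_of_le _ fun l' _ => by
          rw [norm_mul]
          exact mul_le_mul (hP _ _) (hl l' (Finset.mem_univ _)) (norm_nonneg _)
            ((norm_nonneg _).trans (hP l l'))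
      _ = μ * J.card * ‖y l‖ := by simp; ring
  exact le_of_mul_le_mul_right (by linarith) hpos

end Incoherence

section Recovery

variable {N : ℕ}

lemma norm_csgn_le (y : Fin N → ℂ) (l : Fin N) : ‖csgn y l‖ ≤ 1 := by
  unfold csgn
  split_ifs with h
  · simp
  · simp [h]

lemma star_csgn_mul_self (y : Fin N → ℂ) (l : Fin N) : star (csgn y l) * y l = ‖y l‖ := by
  unfold csgn
  split_ifs with h
  · simp [h]
  · have h0 : (‖y l‖ : ℂ) ≠ 0 := by simpa using h
    rw [RCLike.star_def, map_div₀, Complex.conj_ofReal, div_mul_eq_mul_div, Complex.conj_mul', sq,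
      mul_div_assoc, div_self h0, mul_one]

/-- Off the support of `y`, a descent direction of the `ℓ1` norm at `y` is controlled by its
pairing with the sign of `y`. -/
lemma sum_compl_le_norm_star_csgn {y z : Fin N → ℂ} {J : Finset (Fin N)}
    (hJ : ∀ l ∉ J, y l = 0) (h : l1norm (y + z) ≤ l1norm y) :
    ∑ l ∈ Jᶜ, ‖z l‖ ≤ ‖star (csgn y) ⬝ᵥ z‖ := by
  have h1 : l1norm y = ∑ l ∈ J, ‖y l‖ := by
    rw [l1norm, Finset.sum_subset (Finset.subset_univ J) fun l _ hl => by simp [hJ l hl]]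
  have h2 : l1norm (y + z) = ∑ l ∈ J, ‖y l + z l‖ + ∑ l ∈ Jᶜ, ‖z l‖ := by
    rw [l1norm, ← Finset.sum_add_sum_compl J]
    congr 1
    exact Finset.sum_congr rfl fun l hl => by simp [hJ l (Finset.mem_compl.mp hl)]
  have h3 : star (csgn y) ⬝ᵥ z = ∑ l ∈ J, star (csgn y l) * z l := by
    rw [dotProduct, Finset.sum_subset (Finset.subset_univ J) fun l _ hl => by simp [csgn, hJ l hl]]
    rfl
  have h4 : ∑ l ∈ J, ‖y l‖ + (∑ l ∈ J, star (csgn y l) * z l).re ≤ ∑ l ∈ J, ‖y l + z l‖ := by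
    rw [Complex.re_sum, ← Finset.sum_add_distrib]
    refine Finset.sum_le_sum fun l _ => ?_
    calc ‖y l‖ + (star (csgn y l) * z l).re = (star (csgn y l) * (y l + z l)).re := by
          rw [mul_add, star_csgn_mul_self, Complex.add_re, Complex.ofReal_re]
      _ ≤ ‖star (csgn y l) * (y l + z l)‖ := Complex.re_le_norm _
      _ ≤ ‖y l + z l‖ := by
          rw [norm_mul, norm_star]
          exact mul_le_of_le_one_left (norm_nonneg _) (norm_csgn_le y l)
  have h5 := (abs_le.mp (Complex.abs_re_le_norm (star (csgn y) ⬝ᵥ z))).1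
  rw [h3] at h5 ⊢
  linarith

lemma l2norm_le_sum_compl_add_sqrt (z : Fin N → ℂ) (J : Finset (Fin N)) :
    l2norm z ≤ ∑ l ∈ Jᶜ, ‖z l‖ + √(∑ l ∈ J, ‖z l‖ ^ 2) := by
  have hA : 0 ≤ ∑ l ∈ Jᶜ, ‖z l‖ := Finset.sum_nonneg fun _ _ => norm_nonneg _
  refine Real.sqrt_le_iff.mpr ⟨by positivity, ?_⟩
  have h1 : ∑ l ∈ Jᶜ, ‖z l‖ ^ 2 ≤ (∑ l ∈ Jᶜ, ‖z l‖) ^ 2 :=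
    Finset.sum_sq_le_sq_sum_of_nonneg fun _ _ => norm_nonneg _
  rw [← Finset.sum_add_sum_compl J, add_sq, Real.sq_sqrt (by positivity)]
  have := mul_nonneg hA (Real.sqrt_nonneg (∑ l ∈ J, ‖z l‖ ^ 2))
  linarith

lemma l2norm_le_of_dual_bounds {y z : Fin N → ℂ} {J : Finset (Fin N)} (hJ0 : 0 < J.card)
    (hJ : ∀ l ∉ J, y l = 0) (h : l1norm (y + z) ≤ l1norm y) {ρ K : ℝ} (hK : 0 ≤ K)
    (hρ0 : 0 ≤ ρ) (hρ : √J.card * ρ ≤ 1 / 8)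
    (hdual : ∀ q ∈ insert (csgn y) ((fun l => Pi.single l 1) '' (J : Set (Fin N))),
      ‖star q ⬝ᵥ z‖ ≤ l2norm q * (ρ * √(∑ l ∈ J, ‖z l‖ ^ 2)
        + 16 / 15 * (K + 1 / 16 / √J.card * ∑ l ∈ Jᶜ, ‖z l‖))) :
    l2norm z ≤ 3 * (√J.card * K) := by
  refine (l2norm_le_sum_compl_add_sqrt z J).trans ?_
  have hA0 : 0 ≤ ∑ l ∈ Jᶜ, ‖z l‖ := Finset.sum_nonneg fun _ _ => norm_nonneg _
  have hA1 := sum_compl_le_norm_star_csgn hJ h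
  have hs : 0 < √(J.card : ℝ) := Real.sqrt_pos.mpr (by exact_mod_cast hJ0)
  set s := √(J.card : ℝ) with hsdef
  set A := ∑ l ∈ Jᶜ, ‖z l‖
  set B := √(∑ l ∈ J, ‖z l‖ ^ 2) with hBdef
  have hB0 : 0 ≤ B := Real.sqrt_nonneg _
  set X := ρ * B + 16 / 15 * (K + 1 / 16 / s * A) with hX
  have hX0 : 0 ≤ X := by positivity
  have hq : l2norm (csgn y) ≤ s := by
    have := l2norm_le_of_support (v := csgn y) (J := J) (fun l hl => by simp [csgn, hJ l hl])
      zero_le_one fun l _ => norm_csgn_le y l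
    simpa using this
  have hA : A ≤ s * X :=
    (hA1.trans (hdual _ (Set.mem_insert _ _))).trans (mul_le_mul_of_nonneg_right hq hX0)
  have hz : ∀ l ∈ J, ‖z l‖ ≤ X := fun l hl => by
    have h1 := hdual (Pi.single l 1) (Set.mem_insert_of_mem _ ⟨l, hl, rfl⟩)
    have h2 : star (Pi.single l 1 : Fin N → ℂ) ⬝ᵥ z = z l := by
      rw [← Pi.single_star, star_one, single_one_dotProduct]
    have h3 : l2norm (Pi.single l (1 : ℂ)) = 1 := by simp [l2norm, Pi.single_apply, apply_ite]
    rwa [h2, h3, one_mul] at h1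
  have hB : B ≤ s * X := by
    refine Real.sqrt_le_iff.mpr ⟨by positivity, ?_⟩
    rw [mul_pow, hsdef, Real.sq_sqrt (by positivity), ← nsmul_eq_mul, ← Finset.sum_const]
    exact Finset.sum_le_sum fun l hl => pow_le_pow_left₀ (norm_nonneg _) (hz l hl) 2
  have hsX : s * X = (s * ρ) * B + 16 / 15 * (s * K) + 1 / 15 * A := by
    rw [hX]; field_simp; ring
  have h1 : (s * ρ) * B ≤ 1 / 8 * B := mul_le_mul_of_nonneg_right hρ hB0
  have h2 : 0 ≤ s * K := by positivity
  linarith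

end Recovery

section Parameters

lemma natLog_add_one_le {N : ℕ} (hN : 2 ≤ N) : ((Nat.log 2 N + 1 : ℕ) : ℝ) ≤ 3 * Real.log N := by
  have h0 : (2 : ℝ) ≤ N := by exact_mod_cast hN
  have h1 : (Nat.log 2 N : ℝ) * Real.log 2 ≤ Real.log N := by
    rw [← Real.log_pow]
    exact Real.log_le_log (by positivity) (by exact_mod_cast Nat.pow_log_le_self 2 (by omega))
  have h2 := Real.log_two_gt_d9
  have h3 : Real.log 2 ≤ Real.log N := Real.log_le_log (by norm_num) h0
  push_cast
  nlinarith [(Nat.cast_nonneg (Nat.log 2 N) : (0 : ℝ) ≤ _)]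

lemma sqrt_mul_pow_natLog_le {N s : ℕ} (hs : 0 < s) (hsN : s ≤ N) :
    √(s : ℝ) * (1 / 16) ^ (Nat.log 2 N + 1) ≤ 1 / 8 := by
  have h1 : (s : ℝ) ≤ 2 ^ (Nat.log 2 N + 1) := by
    exact_mod_cast hsN.trans (Nat.lt_pow_succ_log_self (by norm_num) N).le
  have h2 : √(s : ℝ) ≤ s :=
    Real.sqrt_le_iff.mpr ⟨by positivity, le_self_pow₀ (by exact_mod_cast hs) two_ne_zero⟩
  calc √(s : ℝ) * (1 / 16) ^ (Nat.log 2 N + 1)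
      ≤ 2 ^ (Nat.log 2 N + 1) * (1 / 16) ^ (Nat.log 2 N + 1) := by gcongr; exact h2.trans h1
    _ = (1 / 8) ^ (Nat.log 2 N + 1) := by rw [← mul_pow]; norm_num
    _ ≤ 1 / 8 := pow_le_of_le_one (by norm_num) (by norm_num) (by omega)

lemma union_bound_le {n N L : ℕ} (hN : 2 ≤ N) (hn : n ≤ N) (hL : L ≤ N) :
    ((N : ℝ) + 1) * (L * ((4 * N + 1 + n) * Real.exp (-(11 * Real.log N)))) ≤ ((N : ℝ) ^ 4)⁻¹ := by
  have h0 : (2 : ℝ) ≤ N := by exact_mod_cast hN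
  have hn' : (n : ℝ) ≤ N := by exact_mod_cast hn
  have hL' : (L : ℝ) ≤ N := by exact_mod_cast hL
  have h1 : Real.exp (-(11 * Real.log N)) = ((N : ℝ) ^ 11)⁻¹ := by
    rw [Real.exp_neg, mul_comm, Real.exp_mul, Real.exp_log (by positivity)]
    norm_cast
  rw [h1]
  have h2 : (16 : ℝ) ≤ N ^ 4 := by
    calc (16 : ℝ) = 2 ^ 4 := by norm_num
      _ ≤ N ^ 4 := by gcongr
  calc ((N : ℝ) + 1) * (L * ((4 * N + 1 + n) * ((N : ℝ) ^ 11)⁻¹))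
      ≤ (2 * N) * (N * ((6 * N) * ((N : ℝ) ^ 11)⁻¹)) := by gcongr <;> linarith
    _ = 12 * N ^ 3 * ((N : ℝ) ^ 11)⁻¹ := by ring
    _ ≤ N ^ 4 * N ^ 3 * ((N : ℝ) ^ 11)⁻¹ := by gcongr; linarith
    _ = ((N : ℝ) ^ 4)⁻¹ := by field_simp

/-- The batch length obtained by splitting `m` samples into `⌊log₂ N⌋ + 1` batches. -/
lemma le_batchLength {N m : ℕ} (hN : 2 ≤ N) {r : ℝ} (hr : 1 ≤ r)
    (hm : 10 ^ 8 * r * Real.log N ^ 4 ≤ m) :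
    10 ^ 6 * r * Real.log N ≤ (m / (Nat.log 2 N + 1) : ℕ) := by
  have h0 : (2 : ℝ) ≤ N := by exact_mod_cast hN
  have h3 : 0.69 ≤ Real.log N := by
    have := Real.log_two_gt_d9
    have := Real.log_le_log (by norm_num) h0
    linarith
  have hL := natLog_add_one_le hN
  set L := Nat.log 2 N + 1 with hLdef
  have hL1 : (1 : ℝ) ≤ L := by exact_mod_cast Nat.succ_le_succ (Nat.zero_le _)
  have h1 : (m : ℝ) < L * ((m / L : ℕ) + 1) := by
    exact_mod_cast Nat.lt_mul_div_succ m (by omega)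
  set ℓ := Real.log N
  have h2 : (0.69 : ℝ) ^ 3 ≤ ℓ ^ 3 := by gcongr
  have h4 : ℓ * (10 ^ 8 * r * ℓ ^ 3) ≤ ℓ * (3 * ((m / L : ℕ) + 1)) := by
    have : (L : ℝ) * ((m / L : ℕ) + 1) ≤ 3 * ℓ * ((m / L : ℕ) + 1) := by gcongr
    nlinarith
  have h5 := le_of_mul_le_mul_left h4 (by linarith)
  have h6 : (0.69 : ℝ) ^ 2 ≤ ℓ ^ 2 := by gcongr
  have h7 : r * ℓ * 0.69 ^ 2 ≤ r * ℓ * ℓ ^ 2 := by gcongr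
  have h8 : 0.69 ≤ r * ℓ := by nlinarith
  nlinarith

end Parameters

section Main

variable {n N m : ℕ}

lemma projMat_mulVec_apply (W : Set (Fin n)) (h : Fin n → ℂ) (i : Fin n) :
    (projMat W).mulVec h i = if i ∈ W then h i else 0 := by
  simp [projMat, Matrix.mulVec, dotProduct, ite_and]

/-- Every minimizer of the `ℓ1` program given by the samples `ω` is within the stated multiple of
the noise level of `x`. -/
def RecoversWithin (T : Matrix (Fin N) (Fin n) ℂ) (ε B : ℝ) (x xsharp : Fin n → ℂ)
    (ω : Fin m → Fin n) : Prop :=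
  l2norm ((projMat (Set.range ω)).mulVec (x - xsharp)) ≤ ε →
    ∀ xhat : Fin n → ℂ,
      l2norm ((projMat (Set.range ω)).mulVec (xhat - xsharp)) ≤ ε →
      (∀ g : Fin n → ℂ, l2norm ((projMat (Set.range ω)).mulVec (g - xsharp)) ≤ ε →
        l1norm (T.mulVec xhat) ≤ l1norm (T.mulVec g)) →
      l2norm (xhat - x) ≤ B

lemma RecoversWithin.mono {T : Matrix (Fin N) (Fin n) ℂ} {ε B B' : ℝ} {x xsharp : Fin n → ℂ}
    {ω : Fin m → Fin n} (h : RecoversWithin T ε B x xsharp ω) (hB : B ≤ B') :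
    RecoversWithin T ε B' x xsharp ω :=
  fun h1 xhat h2 h3 => (h h1 xhat h2 h3).trans hB

lemma recoversWithin_of_mulVec_eq_zero {T : Matrix (Fin N) (Fin n) ℂ}
    (hinj : Function.Injective T.mulVec) {ε B : ℝ} (hB : 0 ≤ B) {x xsharp : Fin n → ℂ}
    (hx : T.mulVec x = 0) (ω : Fin m → Fin n) : RecoversWithin T ε B x xsharp ω := by
  intro h1 xhat _ h3
  have h4 := h3 x h1
  rw [hx] at h4
  have h5 : ∑ l, ‖T.mulVec xhat l‖ ≤ 0 := by simpa [l1norm] using h4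
  have h6 : T.mulVec xhat = T.mulVec x := by
    rw [hx]
    funext l
    have := (Finset.single_le_sum (f := fun l => ‖T.mulVec xhat l‖)
      (fun _ _ => norm_nonneg _) (Finset.mem_univ l)).trans h5
    exact norm_le_zero_iff.mp this
  rw [hinj h6, sub_self]
  simpa [l2norm] using hB

/-- If the golfing scheme started at the sign of `T x` and at the unit vectors on its support does
not fail, the samples recover `x` stably. -/
lemma recoversWithin_of_not_stageFails {T : Matrix (Fin N) (Fin n) ℂ}
    {D : Matrix (Fin n) (Fin N) ℂ} (hT : T * D * T = T) (hD : D * T = 1) (hn : 0 < n)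
    {x xsharp : Fin n → ℂ} {J : Finset (Fin N)} (hJ0 : 0 < J.card)
    (hJ : ∀ l ∉ J, T.mulVec x l = 0) {L k : ℕ} (hk : 0 < k) {ω : Fin m → Fin n}
    (h : L * k ≤ m) {ε t : ℝ} (hε : 0 ≤ ε) (ht : 0 ≤ t)
    (hL : √J.card * (1 / 16) ^ L ≤ 1 / 8) (hNk : J.card * (n * t) ≤ N / 4 * k)
    (hgood : ∀ q ∈ insert (csgn (T.mulVec x)) ((fun l => Pi.single l 1) '' (J : Set (Fin N))),
      ¬ stageFails (batchBad J T D (sigmaMax T) t) (batchStep J T D) L q (batches h ω)) :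
    RecoversWithin T ε (sigmaMax T / sigmaMin T * (14 * √N) * ε) x xsharp ω := by
  intro hx xhat hhat hmin
  set v := xhat - x with hv
  set W := Finset.univ.image ω with hW
  have hmem : ∀ j, ω j ∈ W := fun j => Finset.mem_image_of_mem _ (Finset.mem_univ _)
  have hE : ∑ i ∈ W, ‖v i‖ ^ 2 ≤ (2 * ε) ^ 2 := by
    have h1 : l2norm ((projMat (Set.range ω)).mulVec v) ≤ 2 * ε := by
      have : v = (xhat - xsharp) - (x - xsharp) := by rw [hv]; abel
      rw [this, Matrix.mulVec_sub]
      refine (l2norm_sub_le _ _).trans (by linarith)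
    refine le_trans ?_ (pow_le_pow_left₀ (l2norm_nonneg _) h1 2)
    rw [sq_l2norm]
    refine le_trans (le_of_eq ?_)
      (Finset.sum_le_sum_of_subset_of_nonneg (Finset.subset_univ W) fun _ _ _ => by positivity)
    refine Finset.sum_congr rfl fun i hi => ?_
    rw [projMat_mulVec_apply, if_pos (by simpa [hW] using hi)]
  have hσ : 0 ≤ sigmaMax T := specNorm_nonneg T
  have hmin' : 0 < sigmaMin T := sigmaMin_pos hn hD
  set K := √(2 * sigmaMax T ^ 2 * (2 + n * t / k)) * (2 * ε) with hK
  have hsupp : ∀ q ∈ insert (csgn (T.mulVec x)) ((fun l => Pi.single l 1) '' (J : Set (Fin N))),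
      ∀ l ∉ J, q l = 0 := by
    rintro q (rfl | ⟨i, hi, rfl⟩) l hl
    · simp [csgn, hJ l hl]
    · refine Pi.single_eq_of_ne ?_ 1
      rintro rfl
      exact hl hi
  have hl1 : l1norm (T.mulVec x + T.mulVec v) ≤ l1norm (T.mulVec x) := by
    rw [← Matrix.mulVec_add, hv, add_sub_cancel]
    exact hmin x hx
  have hTv := l2norm_le_of_dual_bounds hJ0 hJ hl1 (K := K) (ρ := (1 / 16) ^ L) (by positivity)
    (by positivity) hL fun q hq => norm_star_dotProduct_le hT hD hJ0 hk hn (by positivity) ht hE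
      (hsupp q hq) (fun i j => hmem _) (hgood q hq)
  have hk' : (0 : ℝ) < k := by exact_mod_cast hk
  have hJN : (J.card : ℝ) ≤ N := by exact_mod_cast (Finset.card_le_univ J).trans_eq (by simp)
  have hsK : 3 * (√J.card * K) ≤ 14 * √N * sigmaMax T * ε := by
    have h1 : √J.card * √(2 * sigmaMax T ^ 2 * (2 + n * t / k))
        ≤ √(9 / 2 * N * sigmaMax T ^ 2) := by
      rw [← Real.sqrt_mul (by positivity)]
      refine Real.sqrt_le_sqrt ?_
      have h2 : (J.card : ℝ) * (n * t / k) ≤ N / 4 := by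
        rw [mul_div_assoc', div_le_iff₀ hk']
        exact hNk
      have h3 : (J.card : ℝ) * (2 + n * t / k) ≤ 9 / 4 * N := by linarith
      calc _ = 2 * sigmaMax T ^ 2 * (J.card * (2 + n * t / k)) := by ring
        _ ≤ 2 * sigmaMax T ^ 2 * (9 / 4 * N) := by gcongr
        _ = _ := by ring
    have h2 : √(9 / 2 * N * sigmaMax T ^ 2) ≤ 7 / 3 * √N * sigmaMax T := by
      refine Real.sqrt_le_iff.mpr ⟨by positivity, ?_⟩
      rw [mul_pow, mul_pow, Real.sq_sqrt (by positivity)]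
      gcongr
      norm_num
    calc 3 * (√J.card * K) = 6 * (√J.card * √(2 * sigmaMax T ^ 2 * (2 + n * t / k))) * ε := by
          rw [hK]; ring
      _ ≤ 6 * (7 / 3 * √N * sigmaMax T) * ε :=
          mul_le_mul_of_nonneg_right (by linarith [h1.trans h2]) hε
      _ = _ := by ring
  have hfin := (sigmaMin_mul_le T v).trans (hTv.trans hsK)
  rw [div_mul_eq_mul_div, div_mul_eq_mul_div, le_div_iff₀ hmin']
  linarith

/-- Recovery with the noise amplification `14 √N`, off an event of probability `N⁻⁴`. -/
lemma unifProb_not_recoversWithin_le {s : ℕ} (hn : 0 < n) (hN : 2 ≤ N)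
    {T : Matrix (Fin N) (Fin n) ℂ} {D : Matrix (Fin n) (Fin N) ℂ} {γ ε : ℝ}
    {x xsharp : Fin n → ℂ} (hinj : Function.Injective T.mulVec) (hMP : IsMoorePenrose T D)
    (hγ : IsBalancing T γ) (hδ : specNorm ((γ : ℂ) • (Tᴴ * T) - 1) < 1)
    (hx : sparsity (T.mulVec x) ≤ s) (hε : 0 ≤ ε)
    (hm : 10 ^ 8 * incoherence γ T Dᴴ * s * Real.log N ^ 4 /
      (1 - specNorm ((γ : ℂ) • (Tᴴ * T) - 1)) ≤ (m : ℝ)) :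
    unifProb (fun ω : Fin m → Fin n =>
      ¬ RecoversWithin T ε (sigmaMax T / sigmaMin T * (14 * √N) * ε) x xsharp ω)
      ≤ ((N : ℝ) ^ 4)⁻¹ := by
  have hγ0 := hγ.1
  have hD : D * T = 1 := left_inverse_of_injective hinj hMP.1
  have hmin : 0 < sigmaMin T := sigmaMin_pos hn hD
  have hσ : 0 < sigmaMax T := hmin.trans_le (sigmaMin_le_sigmaMax hn)
  by_cases hx0 : T.mulVec x = 0
  · have h1 : ∀ ω : Fin m → Fin n,
        RecoversWithin T ε (sigmaMax T / sigmaMin T * (14 * √N) * ε) x xsharp ω :=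
      recoversWithin_of_mulVec_eq_zero hinj (by positivity) hx0
    simp only [h1, not_true_eq_false, unifProb, Finset.filter_false, Finset.card_empty,
      Nat.cast_zero, zero_div]
    positivity
  set μ := incoherence γ T Dᴴ with hμdef
  have hμ0 : 0 ≤ μ := incoherence_nonneg hγ0 _ _
  have hα : ∀ i j, ‖T i j‖ ≤ √(μ / (n * γ)) := fun i j => norm_entry_le_of_locIncoh_le hn hγ0
    ((le_max_left _ _).trans (max_locIncoh_le_incoherence γ T Dᴴ j)) i
  have hβ : ∀ i j, ‖D i j‖ ≤ √(μ * γ / n) := fun i j => by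
    have := norm_entry_le_of_locIncoh_le hn (inv_pos.mpr hγ0)
      ((le_max_right _ _).trans (max_locIncoh_le_incoherence γ T Dᴴ i)) j
    rw [Matrix.conjTranspose_apply, norm_star] at this
    refine this.trans_eq ?_
    rw [← hμdef, div_mul_eq_div_div, div_inv_eq_mul, div_mul_eq_mul_div]
  have hn' : (0 : ℝ) < n := by exact_mod_cast hn
  have hαβ : n * (√(μ / (n * γ)) * √(μ * γ / n)) = μ := by
    rw [← Real.sqrt_mul (by positivity), show μ / (n * γ) * (μ * γ / n) = (μ / n) ^ 2 by
      field_simp, Real.sqrt_sq (by positivity)]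
    field_simp
  have hP : ∀ l l', ‖(T * D) l l'‖ ≤ μ := fun l l' =>
    (norm_mul_entry_le (Real.sqrt_nonneg _) hα hβ l l').trans_eq hαβ
  set J := Finset.univ.filter fun l => T.mulVec x l ≠ 0 with hJdef
  have hJ : ∀ l ∉ J, T.mulVec x l = 0 := fun l hl => by simpa [hJdef] using hl
  have hr : 1 ≤ μ * J.card := one_le_mul_card_of_mulVec_eq hP
    (by rw [Matrix.mulVec_mulVec, hMP.1]) hx0 hJ
  have hJ0 : 0 < J.card := by
    by_contra! h0
    rw [Nat.le_zero.mp h0] at hr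
    norm_num at hr
  have hμ : 0 < μ := hμ0.lt_of_ne fun h0 => by rw [← h0] at hr; norm_num at hr
  have hnN : (n : ℝ) ≤ N * μ := card_le_mul_of_norm_mul_entry_le hD fun l => hP l l
  have hlog : 0 < Real.log N := Real.log_pos (by exact_mod_cast hN)
  have hm' : 10 ^ 8 * (μ * J.card) * Real.log N ^ 4 ≤ m := by
    have hs : (J.card : ℝ) ≤ s := by exact_mod_cast hx
    calc 10 ^ 8 * (μ * J.card) * Real.log N ^ 4 ≤ 10 ^ 8 * (μ * s) * Real.log N ^ 4 := by gcongr
      _ = 10 ^ 8 * μ * s * Real.log N ^ 4 := by ring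
      _ ≤ _ := le_div_self (by positivity) (by linarith)
          (by linarith [specNorm_nonneg ((γ : ℂ) • (Tᴴ * T) - 1)])
      _ ≤ m := hm
  have hklb := le_batchLength hN hr hm'
  set L := Nat.log 2 N + 1 with hLdef
  set k := m / L with hkdef
  have hLk : L * k ≤ m := Nat.mul_div_le m L
  have hr0 : 0 < μ * J.card := by linarith
  have hrl : 0 < μ * J.card * Real.log N := by positivity
  have hk : 0 < k := by
    have : (0 : ℝ) < k := by linarith
    exact_mod_cast this
  have hLN : L ≤ N := Nat.log_lt_self 2 (by omega)
  set t := 11 * Real.log N with htdef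
  have ht0 : 0 ≤ t := by positivity
  have hNk : J.card * (n * t) ≤ N / 4 * k := by
    have h1 : (J.card : ℝ) * (n * t) ≤ J.card * (N * μ * t) := by gcongr
    have h2 : (J.card : ℝ) * (N * μ * t) = N / 4 * (44 * (μ * J.card * Real.log N)) := by
      rw [htdef]; ring
    rw [h2] at h1
    refine h1.trans ?_
    gcongr
    linarith
  have hbad : ∀ q, unifProb (batchBad (k := k) J T D (sigmaMax T) t q)
      ≤ (4 * N + 1 + n) * Real.exp (-t) := by
    refine unifProb_batchBad_le hn hk hJ0 (Real.sqrt_nonneg _) (Real.sqrt_nonneg _) hσ hμ hα hβ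
      (fun q => ?_) hαβ.le ?_ ?_ (by rw [htdef]; linarith)
    · rw [← sq_l2norm, ← mul_pow]
      exact pow_le_pow_left₀ (l2norm_nonneg _) (conjTranspose_l2norm_le T q) 2
    · rw [Real.sq_sqrt (by positivity), show n * (μ / (n * γ)) = μ / γ by field_simp,
        div_le_iff₀ hγ0]
      nlinarith [one_le_balancing_mul_sq hn hmin hγ]
    · rw [Real.sq_sqrt (by positivity),
        show n * (μ * γ / n * sigmaMax T ^ 2) = μ * (γ * sigmaMax T ^ 2) by field_simp]
      nlinarith [balancing_mul_sq_le hγ0 hδ]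
  let q₀ : Option (Fin N) → Fin N → ℂ := fun o => o.elim (csgn (T.mulVec x)) fun l => Pi.single l 1
  have hfail : unifProb (fun ω : Fin m → Fin n => ∃ o, stageFails
      (batchBad J T D (sigmaMax T) t) (batchStep J T D) L (q₀ o) (batches hLk ω))
      ≤ Fintype.card (Option (Fin N)) * (L * ((4 * N + 1 + n) * Real.exp (-t))) :=
    unifProb_exists_le _ fun o => (unifProb_batches_le hLk _).trans
      (unifProb_stageFails_le (by positivity) hbad L _)
  refine (unifProb_mono fun ω hω => ?_).trans (hfail.trans ?_)
  · by_contra! hall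
    refine hω (recoversWithin_of_not_stageFails hMP.1 hD hn hJ0 hJ hk hLk hε ht0
      (sqrt_mul_pow_natLog_le hJ0 ((Finset.card_le_univ J).trans_eq (by simp))) hNk ?_)
    rintro q (rfl | ⟨l, -, rfl⟩)
    · exact hall none
    · exact hall (some l)
  · rw [Fintype.card_option, Fintype.card_fin]
    push_cast
    exact union_bound_le hN (card_le_of_injective hinj) hLN

lemma maxColL2_nonneg (A : Matrix (Fin N) (Fin n) ℂ) : 0 ≤ maxColL2 A :=
  Real.iSup_nonneg fun _ => l2norm_nonneg _

lemma distinctCard_le (ω : Fin m → Fin n) : distinctCard ω ≤ m :=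
  Finset.card_image_le.trans_eq (by simp)

end Main

/-- Theorem 5 (stable recovery with improved noise amplification). -/
theorem stability2_uniform_sampling :
    ∃ C : ℝ, 0 < C ∧
      ∀ (n N m s : ℕ), 0 < n → 0 < N → 0 < m → 0 < s →
      ∀ (T : Matrix (Fin N) (Fin n) ℂ) (Tdag : Matrix (Fin n) (Fin N) ℂ) (γ ε : ℝ)
        (x xsharp : Fin n → ℂ) (ν : Measure (Fin n)) [IsProbabilityMeasure ν],
        Function.Injective T.mulVec →
        IsMoorePenrose T Tdag →
        IsBalancing T γ →
        specNorm ((γ : ℂ) • (Tᴴ * T) - 1) < 1 →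
        (∀ k, ν {k} = (n : ℝ≥0∞)⁻¹) →
        sparsity (T.mulVec x) ≤ s →
        0 ≤ ε →
        (m : ℝ) ≥ C * incoherence γ T Tdagᴴ * s * (Real.log N) ^ 4 /
            (1 - specNorm ((γ : ℂ) • (Tᴴ * T) - 1)) →
        ((Measure.pi fun _ : Fin m => ν)
            {ω | l2norm ((projMat (Set.range ω)).mulVec (x - xsharp)) ≤ ε →
                ∀ xhat : Fin n → ℂ,
                  l2norm ((projMat (Set.range ω)).mulVec (xhat - xsharp)) ≤ ε →
                  (∀ g : Fin n → ℂ,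
                      l2norm ((projMat (Set.range ω)).mulVec (g - xsharp)) ≤ ε →
                      l1norm (T.mulVec xhat) ≤ l1norm (T.mulVec g)) →
                  l2norm (xhat - x) ≤ sigmaMax T / sigmaMin T *
                    (14 * Real.sqrt N + (n : ℝ) / m *
                      (maxColL2 T * maxColL2 Tdagᴴ * ((m : ℝ) - distinctCard ω) + 1)) * ε} ≥
          ENNReal.ofReal (1 - ((N : ℝ) ^ 4)⁻¹)) ∧
        (Tᴴ * T = 1 →
          (Measure.pi fun _ : Fin m => ν)
            {ω | l2norm ((projMat (Set.range ω)).mulVec (x - xsharp)) ≤ ε →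
                ∀ xhat : Fin n → ℂ,
                  l2norm ((projMat (Set.range ω)).mulVec (xhat - xsharp)) ≤ ε →
                  (∀ g : Fin n → ℂ,
                      l2norm ((projMat (Set.range ω)).mulVec (g - xsharp)) ≤ ε →
                      l1norm (T.mulVec xhat) ≤ l1norm (T.mulVec g)) →
                  l2norm (xhat - x) ≤ sigmaMax T / sigmaMin T *
                    (14 * Real.sqrt N + (n : ℝ) / m * maxMult ω) * ε} ≥
          ENNReal.ofReal (1 - ((N : ℝ) ^ 4)⁻¹)) := by
  refine ⟨10 ^ 8, by norm_num, ?_⟩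
  intro n N m s hn hN hm hs T Tdag γ ε x xsharp ν _ hinj hMP hγ hδ hν hx hε hmle
  have key : ∀ B : (Fin m → Fin n) → ℝ, (∀ ω, 0 ≤ B ω) →
      (Measure.pi fun _ : Fin m => ν) {ω | RecoversWithin T ε
        (sigmaMax T / sigmaMin T * (14 * √N + n / m * B ω) * ε) x xsharp ω}
        ≥ ENNReal.ofReal (1 - ((N : ℝ) ^ 4)⁻¹) := by
    intro B hB
    rcases Nat.lt_or_ge N 2 with h2 | h2
    · obtain rfl : N = 1 := by omega
      simp
    refine pi_measure_ge ν hν ((unifProb_mono fun ω hω hrec => hω ?_).trans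
      (unifProb_not_recoversWithin_le (xsharp := xsharp) hn h2 hinj hMP hγ hδ hx hε hmle))
    refine RecoversWithin.mono hrec ?_
    have hσ : 0 < sigmaMin T := sigmaMin_pos hn (left_inverse_of_injective hinj hMP.1)
    have hσ' := sigmaMin_le_sigmaMax (T := T) hn
    have h3 : 0 ≤ sigmaMax T / sigmaMin T := div_nonneg (hσ.le.trans hσ') hσ.le
    have h4 : 0 ≤ (n : ℝ) / m * B ω := mul_nonneg (by positivity) (hB ω)
    gcongr
    linarith
  refine ⟨key _ fun ω => ?_, fun _ => key _ fun ω => Nat.cast_nonneg _⟩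
  have h1 : (distinctCard ω : ℝ) ≤ m := by exact_mod_cast distinctCard_le ω
  have := mul_nonneg (mul_nonneg (maxColL2_nonneg T) (maxColL2_nonneg Tdagᴴ)) (sub_nonneg.mpr h1)
  linarith

end TSR
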